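/- arXiv:1708.07680 — 4 statements merged into one kernel-verified Lean document; each statement's English description precedes it below -/
import Mathlib

section
/- Let J be an ideal of R with Inc(ℕ)·J ⊆ J. Then J has only finitely many distinct initial ideals in_⪯(J) as ⪯ ranges over the Inc(ℕ)-compatible term orders on R. -/
open MvPolynomial

/-- The ambient polynomial ring `R = K[x_{i,j} | i ∈ [c], j ∈ ℕ]`
(second variable indices are written `0`-based). -/
abbrev PolyR (K : Type*) [Field K] (c : ℕ) : Type _ := MvPolynomial (Fin c × ℕ) K

/-- The action of `p : ℕ → ℕ` on variable indices: `x_{i,j} ↦ x_{i,p(j)}`. -/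
def incVar (c : ℕ) (p : ℕ → ℕ) : Fin c × ℕ → Fin c × ℕ := fun v => (v.1, p v.2)

/-- The `K`-linear (in fact `K`-algebra) action of `p : ℕ → ℕ` on `R`. -/
noncomputable def incAct (K : Type*) [Field K] (c : ℕ) (p : ℕ → ℕ) :
    PolyR K c →ₐ[K] PolyR K c := rename (incVar c p)

/-- `Inc(ℕ)_{m,n}`: strictly increasing maps sending the first `m` variable indices
into the first `n` variable indices. -/
def IncIn (m n : ℕ) : Set (ℕ → ℕ) := {p | StrictMono p ∧ ∀ j < m, p j < n}

/-- `R_A`: the polynomials using only variables `x_{i,j}` with `j ∈ A`. -/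
def RsetOn (K : Type*) [Field K] (c : ℕ) (A : Set ℕ) : Set (PolyR K c) :=
  (supported K {v : Fin c × ℕ | v.2 ∈ A} : Subalgebra K (PolyR K c))

/-- `R_n`: the polynomials using only the first `n` variable indices. -/
def Rset (K : Type*) [Field K] (c n : ℕ) : Set (PolyR K c) := RsetOn K c {j | j < n}

/-- `J` is an ideal of the subring of `R` with underlying set `A`. -/
def IsIdealOf {K : Type*} [Field K] {c : ℕ} (J A : Set (PolyR K c)) : Prop :=
  J ⊆ A ∧ (0 : PolyR K c) ∈ J ∧ (∀ f ∈ J, ∀ g ∈ J, f + g ∈ J) ∧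
    ∀ a ∈ A, ∀ f ∈ J, a * f ∈ J

/-- The ideal of the subring of `R` with underlying set `A` generated by `S`. -/
def spanIn {K : Type*} [Field K] {c : ℕ} (A S : Set (PolyR K c)) : Set (PolyR K c) :=
  ⋂₀ {J : Set (PolyR K c) | IsIdealOf J A ∧ S ⊆ J}

/-- The set `Inc(ℕ)_{m,n} · S`. -/
def incOrbit (K : Type*) [Field K] (c m n : ℕ) (S : Set (PolyR K c)) : Set (PolyR K c) :=
  {g | ∃ p ∈ IncIn m n, ∃ f ∈ S, g = incAct K c p f}

/-- An `Inc(ℕ)`-invariant ideal chain in `R`. -/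
def IsIncChain (K : Type*) [Field K] (c : ℕ) (J : ℕ → Set (PolyR K c)) : Prop :=
  (∀ n, IsIdealOf (J n) (Rset K c n)) ∧
    ∀ m n, m ≤ n → incOrbit K c m n (J m) ⊆ J n

/-- The set of indices from which on the chain `J` is generated by `Inc(ℕ)`-shifts. -/
def stabSet (K : Type*) [Field K] (c : ℕ) (J : ℕ → Set (PolyR K c)) : Set ℕ :=
  {N | ∀ n, N ≤ n → spanIn (Rset K c n) (incOrbit K c N n (J N)) = J n}

/-- The stability index `Ind(J∘)` of an ideal chain. -/
noncomputable def Ind (K : Type*) [Field K] (c : ℕ) (J : ℕ → Set (PolyR K c)) : ℕ :=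
  sInf (stabSet K c J)

/-- A term order: a total order on monomials (identified with their exponent vectors,
so that multiplication of monomials becomes addition) which respects multiplication and
has the monomial `1` (exponent vector `0`) as least element. -/
structure TermOrder (σ : Type*) where
  le : (σ →₀ ℕ) → (σ →₀ ℕ) → Prop
  refl : ∀ a, le a a
  trans : ∀ a b c, le a b → le b c → le a c
  antisymm : ∀ a b, le a b → le b a → a = b
  total : ∀ a b, le a b ∨ le b a
  add_right : ∀ a b h, le a b → le (a + h) (b + h)
  zero_le : ∀ a, le 0 a

/-- A term order on `R` is `Inc(ℕ)`-compatible if it is preserved by the action of every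
strictly increasing map. -/
def IncCompatible (c : ℕ) (T : TermOrder (Fin c × ℕ)) : Prop :=
  ∀ p : ℕ → ℕ, StrictMono p → ∀ a b, T.le a b →
    T.le (Finsupp.mapDomain (incVar c p) a) (Finsupp.mapDomain (incVar c p) b)

/-- `a` is the exponent vector of the leading monomial of `f` with respect to `T`. -/
def IsLeadMon {K : Type*} [Field K] {c : ℕ} (T : TermOrder (Fin c × ℕ))
    (f : PolyR K c) (a : (Fin c × ℕ) →₀ ℕ) : Prop :=
  a ∈ f.support ∧ ∀ b ∈ f.support, T.le b a

/-- The set of leading monomials of the nonzero elements of `J`. -/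
def leadMonSet (K : Type*) [Field K] (c : ℕ) (T : TermOrder (Fin c × ℕ))
    (J : Set (PolyR K c)) : Set (PolyR K c) :=
  {g | ∃ f ∈ J, f ≠ 0 ∧ ∃ a, IsLeadMon T f a ∧ g = monomial a (1 : K)}

/-- The initial ideal of `J`, as an ideal of `R_A`. -/
def initialOn (K : Type*) [Field K] (c : ℕ) (T : TermOrder (Fin c × ℕ)) (A : Set ℕ)
    (J : Set (PolyR K c)) : Set (PolyR K c) :=
  spanIn (RsetOn K c A) (leadMonSet K c T J)

/-- The chain of initial ideals `in_T(J_1) ⊆ in_T(J_2) ⊆ ...`. -/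
def inChain (K : Type*) [Field K] (c : ℕ) (T : TermOrder (Fin c × ℕ))
    (J : ℕ → Set (PolyR K c)) : ℕ → Set (PolyR K c) :=
  fun n => initialOn K c T {j | j < n} (J n)

/-- `I(J∘)`: the set of stability indices of initial ideal chains of `J` with respect to
`Inc(ℕ)`-compatible term orders. -/
def IndSet (K : Type*) [Field K] (c : ℕ) (J : ℕ → Set (PolyR K c)) : Set ℕ :=
  {N | ∃ T : TermOrder (Fin c × ℕ), IncCompatible c T ∧ Ind K c (inChain K c T J) = N}

/-- `S_n`: bijections of the variable indices fixing all indices outside the first `n`. -/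
def SymN (n : ℕ) : Set (ℕ → ℕ) := {σ | Function.Bijective σ ∧ ∀ i, n ≤ i → σ i = i}

/-- An `S_∞`-invariant ideal chain in `R`. -/
def IsSymChain (K : Type*) [Field K] (c : ℕ) (J : ℕ → Set (PolyR K c)) : Prop :=
  (∀ n, IsIdealOf (J n) (Rset K c n)) ∧
    ∀ m n, m ≤ n → ∀ σ ∈ SymN n, ∀ f ∈ J m, incAct K c σ f ∈ J n

/-- A family of upper sets of a well-quasi-ordered set is finite if, for every member `A` and
every proper subset `U` of `A`, some finite set disjoint from `U` meets all members. -/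
lemma finite_of_finite_transversals {α : Type*} {r : α → α → Prop} [IsTrans α r] {s : Set α}
    (hs : s.PartiallyWellOrderedOn r) (𝒮 : Set (Set α)) (hsub : ∀ A ∈ 𝒮, A ⊆ s)
    (hup : ∀ A ∈ 𝒮, ∀ x ∈ A, ∀ y ∈ s, r x y → y ∈ A)
    (htrans : ∀ A ∈ 𝒮, ∀ U, U ⊂ A →
      ∃ F : Set α, F.Finite ∧ Disjoint F U ∧ ∀ B ∈ 𝒮, (B ∩ F).Nonempty) :
    𝒮.Finite := by
  let β := {U : Set α // U ⊆ s ∧ ∀ x ∈ U, ∀ y ∈ s, r x y → y ∈ U}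
  have wf : WellFounded fun V U : β => U.1 ⊂ V.1 := by
    rw [wellFounded_iff_isEmpty_descending_chain]
    refine ⟨fun ⟨f, hf⟩ => ?_⟩
    have hmono : Monotone fun n => (f n).1 := monotone_nat_of_le_succ fun n => (hf n).subset
    choose x hx hx' using fun n => Set.exists_of_ssubset (hf n)
    obtain ⟨m, n, hmn, hr⟩ := hs.exists_lt fun n => (f (n + 1)).2.1 (hx n)
    exact hx' n (hmono (Nat.succ_le_of_lt hmn)
      ((f (m + 1)).2.2 _ (hx m) _ ((f (n + 1)).2.1 (hx n)) hr))
  have key : ∀ U : β, {A ∈ 𝒮 | U.1 ⊆ A}.Finite := by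
    intro U
    induction U using wf.induction with
    | _ U ih =>
    by_cases hU : ∃ A ∈ 𝒮, U.1 ⊂ A
    · obtain ⟨A, hA, hUA⟩ := hU
      obtain ⟨F, hF, hFU, hmeet⟩ := htrans A hA U hUA
      have hfin : ∀ x ∈ F, {B ∈ 𝒮 | U.1 ⊆ B ∧ x ∈ B}.Finite := by
        intro x hxF
        by_cases hxs : x ∈ s
        · let V : β := ⟨U.1 ∪ ({x} ∪ {y ∈ s | r x y}), by
            refine Set.union_subset U.2.1 (Set.union_subset (by simpa using hxs) fun y hy => hy.1),
            by
              rintro y (hy | rfl | hy) z hz hyz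
              · exact Or.inl (U.2.2 y hy z hz hyz)
              · exact Or.inr (Or.inr ⟨hz, hyz⟩)
              · exact Or.inr (Or.inr ⟨hz, _root_.trans hy.2 hyz⟩)⟩
          have hUV : U.1 ⊂ V.1 := by
            refine ⟨Set.subset_union_left, fun h => ?_⟩
            exact Set.disjoint_left.1 hFU hxF (h (Or.inr (Or.inl rfl)))
          refine (ih V hUV).subset ?_
          rintro B ⟨hB, hUB, hxB⟩
          refine ⟨hB, ?_⟩
          rintro y (hy | rfl | hy)
          · exact hUB hy
          · exact hxB
          · exact hup B hB x hxB y hy.1 hy.2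
        · refine Set.finite_empty.subset ?_
          rintro B ⟨hB, -, hxB⟩
          exact hxs (hsub B hB hxB)
      refine (hF.biUnion hfin).subset ?_
      rintro B ⟨hB, hUB⟩
      obtain ⟨x, hxB, hxF⟩ := hmeet B hB
      exact Set.mem_biUnion hxF ⟨hB, hUB, hxB⟩
    · refine (Set.finite_singleton U.1).subset ?_
      rintro A ⟨hA, hUA⟩
      by_contra hne
      exact hU ⟨A, hA, hUA.ssubset_of_ne fun h => hne h.symm⟩
  simpa using key ⟨∅, by simp, by simp⟩

namespace TermOrder

variable {σ : Type*} (T : TermOrder σ)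

lemma le_of_le {a b : σ →₀ ℕ} (h : a ≤ b) : T.le a b := by
  have := T.add_right 0 (b - a) a (T.zero_le _)
  rwa [zero_add, tsub_add_cancel_of_le h] at this

lemma exists_max {s : Finset (σ →₀ ℕ)} (hs : s.Nonempty) : ∃ a ∈ s, ∀ b ∈ s, T.le b a := by
  induction hs using Finset.Nonempty.cons_induction with
  | singleton a => exact ⟨a, by simp, by simpa using T.refl a⟩
  | cons a s ha hs ih =>
    obtain ⟨m, hm, hmax⟩ := ih
    rcases T.total a m with h | h
    · exact ⟨m, by simp [hm], by simpa using ⟨h, hmax⟩⟩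
    · exact ⟨a, by simp, by simpa using ⟨T.refl a, fun b hb => T.trans _ _ _ (hmax b hb) h⟩⟩

end TermOrder

/-- The exponent vectors of monomials in the variables `x_{i,j}` with `j < n`. -/
def expsBelow (c n : ℕ) : Set (Fin c × ℕ →₀ ℕ) := {a | ∀ v ∈ a.support, v.2 < n}

lemma expsBelow_of_le {c n : ℕ} {a b : Fin c × ℕ →₀ ℕ} (hb : b ∈ expsBelow c n) (h : a ≤ b) :
    a ∈ expsBelow c n :=
  fun v hv => hb v (Finsupp.support_mono h hv)

lemma expsBelow_add {c n : ℕ} {a b : Fin c × ℕ →₀ ℕ} (ha : a ∈ expsBelow c n)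
    (hb : b ∈ expsBelow c n) : a + b ∈ expsBelow c n := by
  classical
  intro v hv
  rcases Finset.mem_union.1 (Finsupp.support_add hv) with h | h
  exacts [ha v h, hb v h]

lemma expsBelow_mapDomain {c m n : ℕ} {p : ℕ → ℕ} (hp : ∀ j < m, p j < n) {a : Fin c × ℕ →₀ ℕ}
    (ha : a ∈ expsBelow c m) : Finsupp.mapDomain (incVar c p) a ∈ expsBelow c n := by
  classical
  intro v hv
  obtain ⟨w, hw, rfl⟩ := Finset.mem_image.1 (Finsupp.mapDomain_support hv)
  exact hp _ (ha w hw)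

lemma exists_expsBelow {c : ℕ} (s : Finset (Fin c × ℕ →₀ ℕ)) :
    ∃ n, ∀ a ∈ s, a ∈ expsBelow c n := by
  classical
  refine ⟨(s.biUnion fun a => a.support).sup Prod.snd + 1, fun a ha v hv => ?_⟩
  exact Nat.lt_succ_of_le (Finset.le_sup (f := Prod.snd) (Finset.mem_biUnion.2 ⟨a, ha, hv⟩))

lemma incVar_injective (c : ℕ) {p : ℕ → ℕ} (hp : StrictMono p) :
    Function.Injective (incVar c p) := by
  rintro ⟨i, j⟩ ⟨i', j'⟩ h
  simp only [incVar, Prod.mk.injEq] at h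
  exact Prod.ext h.1 (hp.injective h.2)

/-- A term order is a well-order on the monomials in the variables `x_{i,j}` with `j < n`. -/
lemma TermOrder.wellFounded_expsBelow {c : ℕ} (T : TermOrder (Fin c × ℕ)) (n : ℕ) :
    WellFounded fun a b : Fin c × ℕ →₀ ℕ =>
      a ∈ expsBelow c n ∧ b ∈ expsBelow c n ∧ T.le a b ∧ a ≠ b := by
  rw [wellFounded_iff_isEmpty_descending_chain]
  refine ⟨fun ⟨f, hf⟩ => ?_⟩
  obtain ⟨k, l, hkl, hle⟩ := wellQuasiOrdered_le
    fun k => fun v : Fin c × Fin n => f k (v.1, (v.2 : ℕ))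
  have hle' : f k ≤ f l := by
    intro v
    by_cases hv : v ∈ (f k).support
    · exact hle (v.1, ⟨v.2, (hf k).2.1 v hv⟩)
    · simp [Finsupp.notMem_support_iff.1 hv]
  have hanti : ∀ i j, i ≤ j → T.le (f j) (f i) := by
    intro i j hij
    induction j, hij using Nat.le_induction with
    | base => exact T.refl _
    | succ j _ ih => exact T.trans _ _ _ (hf j).2.2.1 ih
  have h1 : T.le (f k) (f (k + 1)) :=
    T.trans _ _ _ (T.le_of_le hle') (hanti (k + 1) l hkl)
  exact (hf k).2.2.2 (T.antisymm _ _ (hf k).2.2.1 h1)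

/-- The pairs `(n, a)` with `a` the exponent vector of a monomial of `R_n`. -/
def levelExps (c : ℕ) : Set (ℕ × (Fin c × ℕ →₀ ℕ)) := {x | x.2 ∈ expsBelow c x.1}

/-- Divisibility of monomials up to shifts by `Inc(ℕ)_{m,n}`. -/
def incDvd (c : ℕ) (x y : ℕ × (Fin c × ℕ →₀ ℕ)) : Prop :=
  ∃ p ∈ IncIn x.1 y.1, Finsupp.mapDomain (incVar c p) x.2 ≤ y.2

instance (c : ℕ) : IsTrans _ (incDvd c) where
  trans := by
    rintro x y z ⟨p, ⟨hp, hpm⟩, hxy⟩ ⟨q, ⟨hq, hqm⟩, hyz⟩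
    refine ⟨q ∘ p, ⟨hq.comp hp, fun j hj => hqm _ (hpm j hj)⟩, ?_⟩
    have hcomp : incVar c (q ∘ p) = incVar c q ∘ incVar c p := rfl
    rw [hcomp, Finsupp.mapDomain_comp]
    obtain ⟨d, hd⟩ := le_iff_exists_add.1 hxy
    refine le_trans ?_ hyz
    rw [hd, Finsupp.mapDomain_add]
    exact le_self_add

/-- The monomials of the rings `R_n` are well-quasi-ordered by divisibility up to shifts. -/
lemma partiallyWellOrderedOn_incDvd (c : ℕ) :
    (levelExps c).PartiallyWellOrderedOn (incDvd c) := by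
  rw [Set.partiallyWellOrderedOn_iff_exists_lt]
  intro f hf
  have hpwo : (Set.univ : Set (Fin c → ℕ)).PartiallyWellOrderedOn (· ≤ ·) := by
    rw [Set.partiallyWellOrderedOn_iff_exists_lt]
    exact fun g _ => wellQuasiOrdered_le g
  let w : ℕ → List (Fin c → ℕ) := fun k => List.ofFn fun j : Fin (f k).1 => fun i => (f k).2 (i, j)
  obtain ⟨k, l, hkl, hw⟩ :=
    (Set.PartiallyWellOrderedOn.partiallyWellOrderedOn_sublistForall₂ _ hpwo).exists_lt
      (f := w) (by simp)
  refine ⟨k, l, hkl, ?_⟩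
  obtain ⟨u, hu, hsub⟩ := List.sublistForall₂_iff.1 hw
  obtain ⟨p, hp⟩ := List.sublist_iff_exists_orderEmbedding_getElem?_eq.1 hsub
  have hlen : u.length = (f k).1 := by rw [← hu.length_eq]; simp [w]
  have hj : ∀ j < (f k).1, ∃ h : p j < (f l).1, ∀ i, (f k).2 (i, j) ≤ (f l).2 (i, p j) := by
    intro j hj
    have hju : j < u.length := by omega
    have h1 := hp j
    rw [List.getElem?_eq_getElem hju] at h1
    obtain ⟨h2, h3⟩ := List.getElem?_eq_some_iff.1 h1.symm
    have h2' : p j < (f l).1 := by simpa [w] using h2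
    refine ⟨h2', fun i => ?_⟩
    have h4 := (List.forall₂_iff_get.1 hu).2 j (by simpa [w] using hj) hju
    simp only [List.get_eq_getElem] at h4
    rw [← h3] at h4
    simpa [w] using h4 i
  refine ⟨p, ⟨p.strictMono, fun j h => (hj j h).1⟩, fun v => ?_⟩
  have hinj := incVar_injective c p.strictMono
  by_cases hv : v ∈ Set.range (incVar c p)
  · obtain ⟨v, rfl⟩ := hv
    rw [Finsupp.mapDomain_apply hinj]
    by_cases h0 : v ∈ (f k).2.support
    · exact (hj v.2 (hf k v h0)).2 v.1
    · simp [Finsupp.notMem_support_iff.1 h0]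
  · simp [Finsupp.mapDomain_of_notMem_range _ _ hv]

/-- The pairs `(n, a)` such that `a` is a leading exponent of an element of `J ∩ R_n`. -/
def leadExps (K : Type*) [Field K] (c : ℕ) (J : Ideal (PolyR K c)) (T : TermOrder (Fin c × ℕ)) :
    Set (ℕ × (Fin c × ℕ →₀ ℕ)) :=
  {x | ∃ f ∈ J, (∀ b ∈ f.support, b ∈ expsBelow c x.1) ∧ IsLeadMon T f x.2}

section

variable {K : Type*} [Field K] {c : ℕ} {J : Ideal (PolyR K c)}

lemma leadMonSet_eq_image_leadExps (T : TermOrder (Fin c × ℕ)) :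
    leadMonSet K c T J = (fun x => monomial x.2 (1 : K)) '' leadExps K c J T := by
  ext g
  constructor
  · rintro ⟨f, hf, -, a, ha, rfl⟩
    obtain ⟨n, hn⟩ := exists_expsBelow f.support
    exact ⟨(n, a), ⟨f, hf, hn, ha⟩, rfl⟩
  · rintro ⟨x, ⟨f, hf, -, ha⟩, rfl⟩
    refine ⟨f, hf, ?_, x.2, ha, rfl⟩
    rintro rfl
    simpa using ha.1

lemma leadExps_subset (T : TermOrder (Fin c × ℕ)) : leadExps K c J T ⊆ levelExps c := by
  rintro x ⟨f, -, hf, ha⟩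
  exact hf _ ha.1

lemma leadExps_upward (hJ : ∀ p : ℕ → ℕ, StrictMono p → ∀ f ∈ J, incAct K c p f ∈ J)
    {T : TermOrder (Fin c × ℕ)} (hT : IncCompatible c T) {x y : ℕ × (Fin c × ℕ →₀ ℕ)}
    (hx : x ∈ leadExps K c J T) (hy : y ∈ levelExps c) (hxy : incDvd c x y) :
    y ∈ leadExps K c J T := by
  classical
  obtain ⟨f, hfJ, hf, ha, hmax⟩ := hx
  obtain ⟨p, ⟨hp, hpm⟩, hle⟩ := hxy
  have hinj := incVar_injective c hp
  set φ := Finsupp.mapDomain (M := ℕ) (incVar c p)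
  set d := y.2 - φ x.2
  have hdy : d + φ x.2 = y.2 := tsub_add_cancel_of_le hle
  have hsupp : ∀ b, b ∈ (monomial d (1 : K) * incAct K c p f).support ↔
      ∃ e ∈ f.support, d + φ e = b := by
    intro b
    rw [incAct, mem_support_iff, coeff_monomial_mul']
    have h1 : ∀ b, coeff b (rename (incVar c p) f) ≠ 0 ↔ ∃ e ∈ f.support, φ e = b := by
      intro b
      rw [← mem_support_iff, support_rename_of_injective hinj, Finset.mem_image]
    by_cases hdb : d ≤ b
    · rw [if_pos hdb, one_mul, h1]
      refine exists_congr fun e => and_congr_right fun _ => ?_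
      rw [eq_tsub_iff_add_eq_of_le hdb, add_comm]
    · rw [if_neg hdb]
      refine iff_of_false (by simp) ?_
      rintro ⟨e, -, rfl⟩
      exact hdb le_self_add
  refine ⟨monomial d (1 : K) * incAct K c p f, J.mul_mem_left _ (hJ p hp f hfJ), ?_, ?_, ?_⟩
  · intro b hb
    obtain ⟨e, he, rfl⟩ := (hsupp b).1 hb
    exact expsBelow_add (expsBelow_of_le hy tsub_le_self) (expsBelow_mapDomain hpm (hf e he))
  · exact (hsupp _).2 ⟨x.2, ha, hdy⟩
  · intro b hb
    obtain ⟨e, he, rfl⟩ := (hsupp b).1 hb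
    rw [← hdy, add_comm d, add_comm d]
    exact T.add_right _ _ _ (hT p hp _ _ (hmax e he))

/-- Reduction modulo leading monomials in `U`: a leading exponent outside `U` is attained by an
element of `J ∩ R_n` none of whose monomials lies in `U`. -/
lemma exists_reduced {T : TermOrder (Fin c × ℕ)} {U : Set (ℕ × (Fin c × ℕ →₀ ℕ))}
    (hU : U ⊆ leadExps K c J T) {n : ℕ} {a : Fin c × ℕ →₀ ℕ} (ha : (n, a) ∈ leadExps K c J T)
    (haU : (n, a) ∉ U) :
    ∃ f ∈ J, (∀ b ∈ f.support, b ∈ expsBelow c n) ∧ IsLeadMon T f a ∧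
      ∀ b ∈ f.support, (n, b) ∉ U := by
  classical
  suffices H : ∀ d ∈ expsBelow c n, ∀ f ∈ J, (∀ b ∈ f.support, b ∈ expsBelow c n) →
      IsLeadMon T f a → (∀ b ∈ f.support, (n, b) ∈ U → T.le b d ∧ b ≠ d) →
      ∃ f ∈ J, (∀ b ∈ f.support, b ∈ expsBelow c n) ∧ IsLeadMon T f a ∧
        ∀ b ∈ f.support, (n, b) ∉ U by
    obtain ⟨f, hfJ, hf, hlead⟩ := ha
    refine H a (hf a hlead.1) f hfJ hf hlead fun b hb hbU => ⟨hlead.2 b hb, ?_⟩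
    rintro rfl
    exact haU hbU
  intro d
  induction d using (T.wellFounded_expsBelow n).induction with
  | _ d ih =>
  intro hd f hfJ hf hlead hfd
  by_cases hne : (f.support.filter fun b => (n, b) ∈ U).Nonempty
  swap
  · refine ⟨f, hfJ, hf, hlead, fun b hb hbU => hne ⟨b, ?_⟩⟩
    exact Finset.mem_filter.2 ⟨hb, hbU⟩
  obtain ⟨e, he, hemax⟩ := T.exists_max hne
  obtain ⟨hef, heU⟩ := Finset.mem_filter.1 he
  obtain ⟨g, hgJ, hg, heg, hgmax⟩ := hU heU
  simp only at hg heg hgmax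
  have hge : coeff e g ≠ 0 := mem_support_iff.1 heg
  set q := coeff e f / coeff e g with hq
  have hcoeff : ∀ b, coeff b (f - C q * g) = coeff b f - q * coeff b g := by simp
  have hsupp : ∀ b ∈ (f - C q * g).support, b ≠ e ∧ (b ∈ f.support ∨ b ∈ g.support) := by
    intro b hb
    rw [mem_support_iff, hcoeff] at hb
    refine ⟨?_, ?_⟩
    · rintro rfl
      exact hb (by rw [hq, div_mul_cancel₀ _ hge, sub_self])
    · by_contra! h
      rw [notMem_support_iff, notMem_support_iff] at h
      simp [h.1, h.2] at hb
  have hea : e ≠ a := by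
    rintro rfl
    exact haU heU
  refine ih e ⟨hf e hef, hd, hfd e hef heU⟩ (hf e hef) (f - C q * g)
    (J.sub_mem hfJ (J.mul_mem_left _ hgJ)) ?_ ⟨?_, ?_⟩ ?_
  · intro b hb
    rcases (hsupp b hb).2 with h | h
    exacts [hf b h, hg b h]
  · have hag : coeff a g = 0 := by
      by_contra h
      exact hea (T.antisymm _ _ (hlead.2 e hef) (hgmax a (mem_support_iff.2 h)))
    rw [mem_support_iff, hcoeff, hag, mul_zero, sub_zero]
    exact mem_support_iff.1 hlead.1
  · intro b hb
    rcases (hsupp b hb).2 with h | h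
    exacts [hlead.2 b h, T.trans _ _ _ (hgmax b h) (hlead.2 e hef)]
  · intro b hb hbU
    refine ⟨?_, (hsupp b hb).1⟩
    rcases (hsupp b hb).2 with h | h
    exacts [hemax b (Finset.mem_filter.2 ⟨h, hbU⟩), hgmax b h]

lemma finite_setOf_leadExps
    (hJ : ∀ p : ℕ → ℕ, StrictMono p → ∀ f ∈ J, incAct K c p f ∈ J) :
    (leadExps K c J '' {T | IncCompatible c T}).Finite := by
  refine finite_of_finite_transversals (partiallyWellOrderedOn_incDvd c) _ ?_ ?_ ?_
  · rintro _ ⟨T, -, rfl⟩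
    exact leadExps_subset T
  · rintro _ ⟨T, hT, rfl⟩ x hx y hy hxy
    exact leadExps_upward hJ hT hx hy hxy
  · rintro _ ⟨T, -, rfl⟩ U hU
    obtain ⟨⟨n, a⟩, ha, haU⟩ := Set.exists_of_ssubset hU
    obtain ⟨f, hfJ, hf, hlead, hfU⟩ := exists_reduced hU.subset ha haU
    refine ⟨Prod.mk n '' (f.support : Set _), f.support.finite_toSet.image _, ?_, ?_⟩
    · rw [Set.disjoint_left]
      rintro _ ⟨b, hb, rfl⟩
      exact hfU b hb
    · rintro _ ⟨T', -, rfl⟩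
      obtain ⟨b, hb, hmax⟩ := T'.exists_max ⟨a, hlead.1⟩
      exact ⟨(n, b), ⟨f, hfJ, hf, hb, hmax⟩, Set.mem_image_of_mem _ hb⟩

end

/-- **Corollary (Statement 13).** Let `J` be an ideal of `R` with `Inc(ℕ)·J ⊆ J`. Then `J`
has only finitely many distinct initial ideals `in_⪯(J)` as `⪯` ranges over the
`Inc(ℕ)`-compatible term orders on `R`. -/
theorem finitely_many_initial_ideals (K : Type*) [Field K] (c : ℕ) (hc : 0 < c)
    (J : Ideal (PolyR K c))
    (hJ : ∀ p : ℕ → ℕ, StrictMono p → ∀ f ∈ J, incAct K c p f ∈ J) :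
    {I : Ideal (PolyR K c) | ∃ T : TermOrder (Fin c × ℕ), IncCompatible c T ∧
      Ideal.span (leadMonSet K c T ↑J) = I}.Finite := by
  refine ((finite_setOf_leadExps hJ).image
    fun A => Ideal.span ((fun x => monomial x.2 (1 : K)) '' A)).subset ?_
  rintro _ ⟨T, hT, rfl⟩
  exact ⟨_, ⟨T, hT, rfl⟩, by rw [leadMonSet_eq_image_leadExps]⟩
end

section
/- Let c = 1 and let M ∈ ℝ^{m×4} be a matrix with pairwise orthogonal nonzero rows representing an Inc(ℕ)-compatible monomial preorder ≺ on R₄ (i.e. x^a ≺ x^b ⇔ M·a <_lex M·b). Then there is a real number λ ≠ 0 such that the first row r₁ of M lies in {(λ,λ,λ,λ), (λ,0,0,0), (0,0,0,λ)}. Moreover, if r₁ = (λ,λ,λ,λ) and m ≥ 2, then the second row r₂ satisfies r₂ ∈ {(−μ,−μ,−μ,3μ), (3μ,−μ,−μ,−μ)} for some μ ≠ 0. -/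
/-- A monomial preorder on `R_n = K[x₁,...,x_n]` (with `c = 1`; monomials are identified
with their exponent vectors in `ℕ₀ⁿ`, multiplication of monomials becoming addition):
a strict partial order on monomials which is multiplicative, cancellative, and whose
incomparability relation is transitive. -/
structure MonomialPreorder (n : ℕ) where
  lt : (Fin n → ℕ) → (Fin n → ℕ) → Prop
  irrefl : ∀ a, ¬ lt a a
  trans : ∀ a b c, lt a b → lt b c → lt a c
  mul : ∀ a b h, lt a b → lt (a + h) (b + h)
  cancel : ∀ a b h, lt (a + h) (b + h) → lt a b
  incomp_trans : ∀ a b c,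
    (¬ lt a b ∧ ¬ lt b a) → (¬ lt b c ∧ ¬ lt c b) → (¬ lt a c ∧ ¬ lt c a)

/-- The transport of an exponent vector `a ∈ ℕ₀⁴` along `p : ℕ → ℕ` (when `p` maps the
support of `a` into the first four indices, this is the exponent vector of `p · x^a`). -/
def pushExp (p : ℕ → ℕ) (a : Fin 4 → ℕ) : Fin 4 → ℕ :=
  fun j => ∑ k : Fin 4, if p (k : ℕ) = (j : ℕ) then a k else 0

/-- A monomial preorder `≺` on `R₄` is `Inc(ℕ)`-compatible if for all monomials
`f, g ∈ R₄` and every strictly increasing `p` with `p·f, p·g ∈ R₄`, `f ≺ g` implies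
`p·f ≺ p·g`. -/
def IncCompatible4 (T : MonomialPreorder 4) : Prop :=
  ∀ p : ℕ → ℕ, StrictMono p → ∀ a b : Fin 4 → ℕ,
    (∀ k : Fin 4, a k ≠ 0 → p (k : ℕ) < 4) → (∀ k : Fin 4, b k ≠ 0 → p (k : ℕ) < 4) →
    T.lt a b → T.lt (pushExp p a) (pushExp p b)

/-- Lexicographic comparison on `ℝ^m`, comparing the first differing coordinates. -/
def lexLtR {m : ℕ} (u v : Fin m → ℝ) : Prop := ∃ i, u i < v i ∧ ∀ k < i, u k = v k

/-- An integral point can be found in any nonempty open cone: a strict inequality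
`0 < x ⬝ᵥ u`, `x ⬝ᵥ v < 0` solvable over `ℝ` is solvable over `ℤ`. -/
lemma exists_int_dotProduct_pos_neg {ι : Type*} [Fintype ι] {u v x : ι → ℝ}
    (hu : 0 < x ⬝ᵥ u) (hv : x ⬝ᵥ v < 0) :
    ∃ d : ι → ℤ, 0 < (fun i => (d i : ℝ)) ⬝ᵥ u ∧ (fun i => (d i : ℝ)) ⬝ᵥ v < 0 := by
  have hopen : IsOpen {y : ι → ℝ | 0 < y ⬝ᵥ u ∧ y ⬝ᵥ v < 0} := by
    simp only [dotProduct, Set.ofPred_and]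
    exact (isOpen_lt (by fun_prop) (by fun_prop)).inter (isOpen_lt (by fun_prop) (by fun_prop))
  have hdense : DenseRange (Pi.map fun _ : ι => ((↑) : ℚ → ℝ)) :=
    DenseRange.piMap fun _ => Rat.denseRange_cast
  obtain ⟨q, hqu, hqv⟩ := hdense.exists_mem_open hopen ⟨x, hu, hv⟩
  obtain ⟨b, hb⟩ := IsLocalization.exist_integer_multiples_of_finite (nonZeroDivisors ℤ) q
  choose d hd using hb
  have hb0 : ((b : ℤ) : ℝ) ≠ 0 := by exact_mod_cast nonZeroDivisors.coe_ne_zero b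
  have key : ∀ w : ι → ℝ, (fun i => (((b : ℤ) * d i : ℤ) : ℝ)) ⬝ᵥ w
      = ((b : ℤ) : ℝ) ^ 2 * (Pi.map (fun _ : ι => ((↑) : ℚ → ℝ)) q ⬝ᵥ w) := by
    intro w
    simp only [dotProduct, Finset.mul_sum]
    refine Finset.sum_congr rfl fun i _ => ?_
    have h : (d i : ℚ) = (b : ℤ) * q i := by simpa using hd i
    have h' : (d i : ℝ) = ((b : ℤ) : ℝ) * (q i : ℝ) := by
      exact_mod_cast congrArg (Rat.cast (K := ℝ)) h
    simp only [Pi.map_apply]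
    push_cast
    rw [h']
    ring
  refine ⟨fun i => (b : ℤ) * d i, ?_, ?_⟩
  · rw [key]
    exact mul_pos (by positivity) hqu
  · rw [key]
    exact mul_neg_of_pos_of_neg (by positivity) hqv

/-- If the open half-space of `u ≠ 0` is contained, on integral points, in the closed half-space
of `v`, then `v` is a nonnegative multiple of `u`. -/
lemma exists_nonneg_smul_of_int_halfSpace {ι : Type*} [Fintype ι] {u v : ι → ℝ} (hu : u ≠ 0)
    (h : ∀ d : ι → ℤ, 0 < (fun i => (d i : ℝ)) ⬝ᵥ u → 0 ≤ (fun i => (d i : ℝ)) ⬝ᵥ v) :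
    ∃ c : ℝ, 0 ≤ c ∧ v = c • u := by
  have hreal : ∀ x : ι → ℝ, 0 < x ⬝ᵥ u → 0 ≤ x ⬝ᵥ v := by
    intro x hx
    by_contra! hxv
    obtain ⟨d, hdu, hdv⟩ := exists_int_dotProduct_pos_neg hx hxv
    exact (h d hdu).not_gt hdv
  have hs : 0 < u ⬝ᵥ u :=
    lt_of_le_of_ne (Finset.sum_nonneg fun i _ => mul_self_nonneg (u i))
      fun h0 => hu (dotProduct_self_eq_zero.mp h0.symm)
  have ht : 0 ≤ u ⬝ᵥ v := hreal u hs
  have hcs : (u ⬝ᵥ u) * (v ⬝ᵥ v) ≤ (u ⬝ᵥ v) ^ 2 := by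
    by_contra! hlt
    set ε := ((u ⬝ᵥ u) * (v ⬝ᵥ v) - (u ⬝ᵥ v) ^ 2) / (2 * (u ⬝ᵥ v + 1)) with hε
    have hε0 : 0 < ε := div_pos (by linarith) (by linarith)
    have hε1 : ε * (2 * (u ⬝ᵥ v + 1)) = (u ⬝ᵥ u) * (v ⬝ᵥ v) - (u ⬝ᵥ v) ^ 2 :=
      div_mul_cancel₀ _ (by linarith)
    have := hreal ((u ⬝ᵥ v + ε) • u - (u ⬝ᵥ u) • v) (by
      rw [sub_dotProduct, smul_dotProduct, smul_dotProduct, dotProduct_comm v u]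
      simp only [smul_eq_mul]
      nlinarith [mul_pos hε0 hs])
    rw [sub_dotProduct, smul_dotProduct, smul_dotProduct] at this
    simp only [smul_eq_mul] at this
    nlinarith [mul_nonneg hε0.le ht]
  refine ⟨(u ⬝ᵥ v) / (u ⬝ᵥ u), by positivity, ?_⟩
  have hw : (u ⬝ᵥ u) • v - (u ⬝ᵥ v) • u = 0 := by
    rw [← dotProduct_self_eq_zero]
    refine le_antisymm ?_ (Finset.sum_nonneg fun i _ => mul_self_nonneg _)
    simp only [sub_dotProduct, dotProduct_sub, smul_dotProduct, dotProduct_smul, smul_eq_mul,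
      dotProduct_comm v u]
    nlinarith
  rw [div_eq_inv_mul, mul_smul, ← sub_eq_zero.mp hw, inv_smul_smul₀ hs.ne']

lemma lexLtR_of_lt {m : ℕ} {u v : Fin m → ℝ} {i : Fin m} (heq : ∀ k < i, u k = v k)
    (hlt : u i < v i) : lexLtR u v := ⟨i, hlt, heq⟩

lemma le_of_lexLtR {m : ℕ} {u v : Fin m → ℝ} {i : Fin m} (heq : ∀ k < i, u k = v k)
    (h : lexLtR u v) : u i ≤ v i := by
  obtain ⟨j, hj, hjk⟩ := h
  rcases lt_trichotomy i j with hij | rfl | hij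
  · exact (hjk i hij).le
  · exact hj.le
  · exact absurd (heq j hij) hj.ne

/-- The strictly increasing map `ℕ → ℕ` that omits exactly the value `j`. -/
def skipValue (j n : ℕ) : ℕ := if n < j then n else n + 1

lemma strictMono_skipValue (j : ℕ) : StrictMono (skipValue j) := by
  intro a b hab
  unfold skipValue
  split_ifs <;> omega

lemma sum_mul_pushExp_skipValue (w : Fin 4 → ℝ) (j : Fin 4) (a : Fin 3 → ℕ) :
    ∑ k : Fin 4, w k * (pushExp (skipValue j) (Fin.snoc a 0 : Fin 4 → ℕ) k : ℝ)
      = ∑ t : Fin 3, w (j.succAbove t) * (a t : ℝ) := by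
  have e0 : (Fin.snoc a 0 : Fin 4 → ℕ) 0 = a 0 := rfl
  have e1 : (Fin.snoc a 0 : Fin 4 → ℕ) 1 = a 1 := rfl
  have e2 : (Fin.snoc a 0 : Fin 4 → ℕ) 2 = a 2 := rfl
  have e3 : (Fin.snoc a 0 : Fin 4 → ℕ) 3 = 0 := rfl
  fin_cases j <;>
    simp [pushExp, skipValue, Fin.sum_univ_four, Fin.sum_univ_three, Fin.succAbove,
      e0, e1, e2, e3, Fin.lt_def]

lemma sum_mul_snoc_zero (w : Fin 4 → ℝ) (a : Fin 3 → ℕ) :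
    ∑ k : Fin 4, w k * ((Fin.snoc a 0 : Fin 4 → ℕ) k : ℝ)
      = ∑ t : Fin 3, w t.castSucc * (a t : ℝ) := by
  rw [Fin.sum_univ_castSucc]
  simp only [Fin.snoc_castSucc, Fin.snoc_last, Nat.cast_zero, mul_zero, add_zero]

lemma sum_mul_toNat_sub (w : Fin 3 → ℝ) (d : Fin 3 → ℤ) :
    ∑ t, w t * ((d t).toNat : ℝ) - ∑ t, w t * ((-d t).toNat : ℝ)
      = (fun t => (d t : ℝ)) ⬝ᵥ w := by
  rw [← Finset.sum_sub_distrib]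
  refine Finset.sum_congr rfl fun t _ => ?_
  have h : (((d t).toNat : ℤ) : ℝ) - (((-d t).toNat : ℤ) : ℝ) = (d t : ℝ) := by
    exact_mod_cast Int.toNat_sub_toNat_neg (d t)
  simp only [Int.cast_natCast] at h
  rw [← mul_sub, h, mul_comm]

/-- Compatibility, read off on the `i`-th row of the matrix: if the earlier rows do not separate
the monomials in question, then the sign of the `i`-th row is preserved by `skipValue j`. -/
lemma dotProduct_succAbove_nonneg {m : ℕ} {M : Fin m → Fin 4 → ℝ} {T : MonomialPreorder 4}
    (hT : IncCompatible4 T)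
    (hrep : ∀ a b : Fin 4 → ℕ, T.lt a b ↔
      lexLtR (fun i => ∑ k : Fin 4, M i k * (a k : ℝ))
        (fun i => ∑ k : Fin 4, M i k * (b k : ℝ)))
    (i : Fin m) (j : Fin 4) (d : Fin 3 → ℤ)
    (hdom : ∀ k < i, (fun t => (d t : ℝ)) ⬝ᵥ (fun t : Fin 3 => M k t.castSucc) = 0)
    (himg : ∀ k < i, (fun t => (d t : ℝ)) ⬝ᵥ (fun t : Fin 3 => M k (j.succAbove t)) = 0)
    (hpos : 0 < (fun t => (d t : ℝ)) ⬝ᵥ (fun t : Fin 3 => M i t.castSucc)) :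
    0 ≤ (fun t => (d t : ℝ)) ⬝ᵥ (fun t : Fin 3 => M i (j.succAbove t)) := by
  have hsupp : ∀ (a : Fin 3 → ℕ) (k : Fin 4), (Fin.snoc a 0 : Fin 4 → ℕ) k ≠ 0 →
      skipValue j k < 4 := by
    intro a k
    induction k using Fin.lastCases with
    | last => exact fun h => absurd (Fin.snoc_last (α := fun _ : Fin 4 => ℕ) 0 a) h
    | cast t =>
      intro _
      have := t.isLt
      simp only [skipValue, Fin.val_castSucc]
      split_ifs <;> omega
  have hlt := hT (skipValue j) (strictMono_skipValue j) (Fin.snoc (fun t => (-d t).toNat) 0)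
    (Fin.snoc (fun t => (d t).toNat) 0) (hsupp _) (hsupp _) ((hrep _ _).2 <| by
      simp only [sum_mul_snoc_zero]
      refine lexLtR_of_lt (i := i) (fun k hk => ?_) ?_
      · linarith [hdom k hk, sum_mul_toNat_sub (fun t => M k t.castSucc) d]
      · linarith [hpos, sum_mul_toNat_sub (fun t => M i t.castSucc) d])
  rw [hrep] at hlt
  simp only [sum_mul_pushExp_skipValue] at hlt
  rw [← sum_mul_toNat_sub, sub_nonneg]
  refine le_of_lexLtR (i := i) (fun k hk => ?_) hlt
  linarith [himg k hk, sum_mul_toNat_sub (fun t => M k (j.succAbove t)) d]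

/-- A vector of `ℝ⁴` whose restriction to any three coordinates is a nonnegative multiple of its
restriction to the first three is constant or supported on its first coordinate. -/
lemma eq_of_triples_proportional {x y z w c₁ c₂ c₃ : ℝ}
    (hne : ¬ (x = 0 ∧ y = 0 ∧ z = 0))
    (h₁ : x = c₁ * x ∧ y = c₁ * y ∧ w = c₁ * z)
    (h₂ : x = c₂ * x ∧ z = c₂ * y ∧ w = c₂ * z)
    (h₃ : y = c₃ * x ∧ z = c₃ * y ∧ w = c₃ * z) :
    x ≠ 0 ∧ (y = x ∧ z = x ∧ w = x ∨ y = 0 ∧ z = 0 ∧ w = 0) := by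
  have hx : x ≠ 0 := by
    rintro rfl
    have hy : y = 0 := by linarith [h₃.1]
    subst hy
    exact hne ⟨rfl, rfl, by linarith [h₃.2.1]⟩
  have hc₂ : c₂ = 1 := mul_right_cancel₀ hx (by linarith [h₂.1])
  obtain ⟨-, hz, hw⟩ := h₂
  rw [hc₂, one_mul] at hz hw
  refine ⟨hx, ?_⟩
  by_cases hy : y = 0
  · right
    exact ⟨hy, by linarith, by linarith⟩
  · left
    have hc₃ : c₃ = 1 := mul_right_cancel₀ hy (by linarith [h₃.2.1])
    have hyx : y = x := by simpa [hc₃] using h₃.1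
    exact ⟨hyx, by linarith, by linarith⟩

/-- The analogue of `eq_of_triples_proportional` modulo constant vectors, in terms of the
successive differences of the coordinates. -/
lemma eq_zero_of_differences_proportional {x y z c₁ c₃ : ℝ} (hne : ¬ (x = 0 ∧ y = 0))
    (h₁ : x = c₁ * x ∧ y + z = c₁ * y)
    (h₃ : y = c₃ * x ∧ z = c₃ * y) :
    y = 0 ∧ z = 0 := by
  have hx : x ≠ 0 := fun hx => hne ⟨hx, by simpa [hx] using h₃.1⟩
  have hc₁ : c₁ = 1 := mul_right_cancel₀ hx (by linarith [h₁.1])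
  have hz : z = 0 := by linarith [hc₁ ▸ h₁.2]
  refine ⟨?_, hz⟩
  by_contra hy
  have h : c₃ * y = 0 := by linarith [h₃.2]
  rcases mul_eq_zero.mp h with h | h
  · exact hy (by simpa [h] using h₃.1)
  · exact hy h

/-- **Lemma (Statement 15).** Let `M ∈ ℝ^{m×4}` be a matrix with pairwise orthogonal
nonzero rows representing an `Inc(ℕ)`-compatible monomial preorder `≺` on `R₄`
(i.e. `x^a ≺ x^b ⇔ M·a <_lex M·b`). Then there is `λ ≠ 0` such that the first row of `M`
lies in `{(λ,λ,λ,λ), (λ,0,0,0), (0,0,0,λ)}`; moreover, if the first row is `(λ,λ,λ,λ)`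
and `m ≥ 2`, then the second row is `(−μ,−μ,−μ,3μ)` or `(3μ,−μ,−μ,−μ)` for some `μ ≠ 0`. -/
theorem matrix_of_incCompatible_monomialPreorder (m : ℕ) (hm : 0 < m)
    (M : Fin m → Fin 4 → ℝ)
    (hnz : ∀ i, M i ≠ 0)
    (horth : ∀ i j, i ≠ j → ∑ k : Fin 4, M i k * M j k = 0)
    (T : MonomialPreorder 4) (hT : IncCompatible4 T)
    (hrep : ∀ a b : Fin 4 → ℕ, T.lt a b ↔
      lexLtR (fun i => ∑ k : Fin 4, M i k * (a k : ℝ))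
        (fun i => ∑ k : Fin 4, M i k * (b k : ℝ))) :
    (∃ l : ℝ, l ≠ 0 ∧
      (M ⟨0, hm⟩ = ![l, l, l, l] ∨ M ⟨0, hm⟩ = ![l, 0, 0, 0] ∨ M ⟨0, hm⟩ = ![0, 0, 0, l])) ∧
    ∀ (h2 : 2 ≤ m) (l : ℝ), l ≠ 0 → M ⟨0, hm⟩ = ![l, l, l, l] →
      ∃ mu : ℝ, mu ≠ 0 ∧
        (M ⟨1, h2⟩ = ![-mu, -mu, -mu, 3 * mu] ∨ M ⟨1, h2⟩ = ![3 * mu, -mu, -mu, -mu]) := by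
  refine ⟨?_, ?_⟩
  · have hprop : ∀ j : Fin 4, (fun t : Fin 3 => M ⟨0, hm⟩ t.castSucc) ≠ 0 →
        ∃ c : ℝ, 0 ≤ c ∧ (fun t : Fin 3 => M ⟨0, hm⟩ (j.succAbove t))
          = c • fun t : Fin 3 => M ⟨0, hm⟩ t.castSucc := fun j hne =>
      exists_nonneg_smul_of_int_halfSpace hne fun d =>
        dotProduct_succAbove_nonneg hT hrep _ j d
          (fun k hk => absurd hk (Nat.not_lt_zero _)) (fun k hk => absurd hk (Nat.not_lt_zero _))
    have hnz0 := hnz ⟨0, hm⟩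
    generalize M ⟨0, hm⟩ = r at hprop hnz0 ⊢
    have hr : r = ![r 0, r 1, r 2, r 3] := by ext k; fin_cases k <;> rfl
    by_cases hne : (fun t : Fin 3 => r t.castSucc) = 0
    · have h0 : r 0 = 0 := congrFun hne 0
      have h1 : r 1 = 0 := congrFun hne 1
      have h2 : r 2 = 0 := congrFun hne 2
      rw [h0, h1, h2] at hr
      refine ⟨r 3, fun h3 => hnz0 ?_, Or.inr (Or.inr hr)⟩
      rw [hr, h3]
      ext k; fin_cases k <;> rfl
    · obtain ⟨c₁, -, h₁⟩ := hprop 2 hne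
      obtain ⟨c₂, -, h₂⟩ := hprop 1 hne
      obtain ⟨c₃, -, h₃⟩ := hprop 0 hne
      obtain ⟨hx, ⟨hy, hz, hw⟩ | ⟨hy, hz, hw⟩⟩ := eq_of_triples_proportional
        (x := r 0) (y := r 1) (z := r 2) (w := r 3)
        (fun ⟨h0, h1, h2⟩ => hne (by ext t; fin_cases t <;> assumption))
        ⟨congrFun h₁ 0, congrFun h₁ 1, congrFun h₁ 2⟩
        ⟨congrFun h₂ 0, congrFun h₂ 1, congrFun h₂ 2⟩
        ⟨congrFun h₃ 0, congrFun h₃ 1, congrFun h₃ 2⟩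
      · exact ⟨r 0, hx, Or.inl (by rw [hy, hz, hw] at hr; exact hr)⟩
      · exact ⟨r 0, hx, Or.inr (Or.inl (by rw [hy, hz, hw] at hr; exact hr))⟩
  · intro h2 l hl hM0
    have hsum : M ⟨1, h2⟩ 0 + M ⟨1, h2⟩ 1 + M ⟨1, h2⟩ 2 + M ⟨1, h2⟩ 3 = 0 := by
      have h := horth ⟨0, hm⟩ ⟨1, h2⟩ (by simp)
      rw [hM0] at h
      simp only [Fin.sum_univ_four] at h
      refine mul_left_cancel₀ hl ?_
      rw [mul_zero, ← h]
      simp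
      ring
    have hprop : ∀ j : Fin 4,
        ![M ⟨1, h2⟩ 1 - M ⟨1, h2⟩ 0, M ⟨1, h2⟩ 2 - M ⟨1, h2⟩ 1] ≠ 0 →
        ∃ c : ℝ, 0 ≤ c ∧ ![M ⟨1, h2⟩ (j.succAbove 1) - M ⟨1, h2⟩ (j.succAbove 0),
            M ⟨1, h2⟩ (j.succAbove 2) - M ⟨1, h2⟩ (j.succAbove 1)]
          = c • ![M ⟨1, h2⟩ 1 - M ⟨1, h2⟩ 0, M ⟨1, h2⟩ 2 - M ⟨1, h2⟩ 1] := by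
      refine fun j hne => exists_nonneg_smul_of_int_halfSpace hne fun d hd => ?_
      have hdiff : ∀ w : Fin 3 → ℝ, (fun t => ((![-d 0, d 0 - d 1, d 1] t : ℤ) : ℝ)) ⬝ᵥ w
          = (fun t => (d t : ℝ)) ⬝ᵥ ![w 1 - w 0, w 2 - w 1] := by
        intro w
        simp [dotProduct, Fin.sum_univ_three]
        ring
      have hconst : ∀ k < (⟨1, h2⟩ : Fin m), ∀ s, M k s = l := by
        intro k hk s
        obtain rfl : k = ⟨0, hm⟩ := Fin.ext (Nat.lt_one_iff.mp hk)
        rw [hM0]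
        fin_cases s <;> rfl
      have h := dotProduct_succAbove_nonneg hT hrep ⟨1, h2⟩ j ![-d 0, d 0 - d 1, d 1]
        (fun k hk => by simp only [hconst k hk, hdiff]; simp)
        (fun k hk => by simp only [hconst k hk, hdiff]; simp)
        (by rw [hdiff]; exact hd)
      rwa [hdiff] at h
    have hnz1 := hnz ⟨1, h2⟩
    generalize M ⟨1, h2⟩ = r at hprop hnz1 hsum ⊢
    have hr : r = ![r 0, r 1, r 2, r 3] := by ext k; fin_cases k <;> rfl
    by_cases hne : ![r 1 - r 0, r 2 - r 1] = 0
    · have h0 : r 1 - r 0 = 0 := congrFun hne 0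
      have h1 : r 2 - r 1 = 0 := congrFun hne 1
      refine ⟨-r 1, fun h => hnz1 ?_, Or.inl ?_⟩
      · rw [hr]
        ext k; fin_cases k <;> simp <;> linarith
      · rw [hr]
        ext k; fin_cases k <;> simp <;> linarith
    · obtain ⟨c₁, -, h₁⟩ := hprop 2 hne
      obtain ⟨c₃, -, h₃⟩ := hprop 0 hne
      have a₁ : r 1 - r 0 = c₁ * (r 1 - r 0) := congrFun h₁ 0
      have b₁ : r 3 - r 1 = c₁ * (r 2 - r 1) := congrFun h₁ 1
      have a₃ : r 2 - r 1 = c₃ * (r 1 - r 0) := congrFun h₃ 0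
      have b₃ : r 3 - r 2 = c₃ * (r 2 - r 1) := congrFun h₃ 1
      obtain ⟨hy, hz⟩ := eq_zero_of_differences_proportional
        (fun ⟨h0, h1⟩ => hne (by ext t; fin_cases t <;> assumption))
        ⟨a₁, by linarith⟩ ⟨a₃, b₃⟩
      refine ⟨-r 1, fun h => hnz1 ?_, Or.inr ?_⟩
      · rw [hr]
        ext k; fin_cases k <;> simp <;> linarith
      · rw [hr]
        ext k; fin_cases k <;> simp <;> linarith
end

section
/- Let c = 1, i ∈ ℕ, n ≥ i, and ≺ a monomial preorder on R_n. (1) If x₁ and x_j are incomparable with respect to ≺ for all j ∈ [i], then any two monomials f, g ∈ R_i with deg(f) = deg(g) are incomparable. (2) If 1 and x_j are incomparable with respect to ≺ for all j ∈ [i], then every pair of monomials f, g ∈ R_i is incomparable. -/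
/-- Two monomials are incomparable with respect to `T`. -/
def Incomp {n : ℕ} (T : MonomialPreorder n) (a b : Fin n → ℕ) : Prop :=
  ¬ T.lt a b ∧ ¬ T.lt b a

namespace Incomp

variable {n : ℕ} {T : MonomialPreorder n} {a b c d : Fin n → ℕ}

theorem refl (T : MonomialPreorder n) (a : Fin n → ℕ) : Incomp T a a :=
  ⟨T.irrefl a, T.irrefl a⟩

theorem symm (h : Incomp T a b) : Incomp T b a :=
  ⟨h.2, h.1⟩

theorem trans (h₁ : Incomp T a b) (h₂ : Incomp T b c) : Incomp T a c :=
  T.incomp_trans a b c h₁ h₂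

theorem add_right (h : Incomp T a b) (e : Fin n → ℕ) : Incomp T (a + e) (b + e) :=
  ⟨fun hlt => h.1 (T.cancel _ _ e hlt), fun hlt => h.2 (T.cancel _ _ e hlt)⟩

theorem add (h₁ : Incomp T a b) (h₂ : Incomp T c d) : Incomp T (a + c) (b + d) := by
  have h := h₂.add_right b
  rw [add_comm c b, add_comm d b] at h
  exact (h₁.add_right c).trans h

theorem nsmul (h : Incomp T a b) (m : ℕ) : Incomp T (m • a) (m • b) := by
  induction m with
  | zero => simpa using refl T 0
  | succ m ih => simpa only [succ_nsmul] using ih.add h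

theorem sum {ι : Type*} (s : Finset ι) {f g : ι → Fin n → ℕ}
    (h : ∀ k ∈ s, Incomp T (f k) (g k)) : Incomp T (∑ k ∈ s, f k) (∑ k ∈ s, g k) := by
  classical
  induction s using Finset.induction_on with
  | empty => simpa using refl T 0
  | insert k s hk ih =>
    rw [Finset.sum_insert hk, Finset.sum_insert hk]
    exact (h k (Finset.mem_insert_self k s)).add
      (ih fun l hl => h l (Finset.mem_insert_of_mem hl))

/-- If `u` is incomparable with every variable occurring in `f`, then `f` is incomparable
with the power of `u` whose exponent is the degree of `f`. -/
theorem degree_nsmul {u f : Fin n → ℕ} (h : ∀ k, f k ≠ 0 → Incomp T u (Pi.single k 1)) :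
    Incomp T ((∑ k, f k) • u) f := by
  have hf : f = ∑ k, f k • (Pi.single k 1 : Fin n → ℕ) := by
    simp_rw [← Pi.single_smul, smul_eq_mul, mul_one]
    exact (Finset.univ_sum_single f).symm
  have key : Incomp T (∑ k, f k • u) (∑ k, f k • (Pi.single k 1 : Fin n → ℕ)) := by
    refine sum _ fun k _ => ?_
    by_cases hk : f k = 0
    · simpa [hk] using refl T 0
    · exact (h k hk).nsmul (f k)
  rwa [← hf, ← Finset.sum_smul] at key

end Incomp

/-- **Lemma (Statement 16).** Let `i ∈ ℕ`, `n ≥ i`, and `≺` a monomial preorder on `R_n`.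
(1) If `x₁` and `x_j` are incomparable for all `j ∈ [i]`, then any two monomials
`f, g ∈ R_i` with `deg f = deg g` are incomparable.
(2) If `1` and `x_j` are incomparable for all `j ∈ [i]`, then every pair of monomials
`f, g ∈ R_i` is incomparable.
(Variables are indexed `0`-based: `x₁` is `Pi.single 0 1`, `[i]` becomes `{j | j < i}`,
and `f ∈ R_i` means that `f` uses only the first `i` variables.) -/
theorem incomparability_propagates (n i : ℕ) (hi : 1 ≤ i) (hin : i ≤ n)
    (T : MonomialPreorder n) :
    ((∀ j : Fin n, (j : ℕ) < i →
        Incomp T (Pi.single (⟨0, by omega⟩ : Fin n) 1) (Pi.single j 1)) →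
      ∀ f g : Fin n → ℕ,
        (∀ k : Fin n, i ≤ (k : ℕ) → f k = 0) → (∀ k : Fin n, i ≤ (k : ℕ) → g k = 0) →
        (∑ k, f k) = (∑ k, g k) → Incomp T f g) ∧
    ((∀ j : Fin n, (j : ℕ) < i → Incomp T 0 (Pi.single j 1)) →
      ∀ f g : Fin n → ℕ,
        (∀ k : Fin n, i ≤ (k : ℕ) → f k = 0) → (∀ k : Fin n, i ≤ (k : ℕ) → g k = 0) →
        Incomp T f g) := by
  have key : ∀ u : Fin n → ℕ, (∀ j : Fin n, (j : ℕ) < i → Incomp T u (Pi.single j 1)) →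
      ∀ f : Fin n → ℕ, (∀ k : Fin n, i ≤ (k : ℕ) → f k = 0) →
        Incomp T ((∑ k, f k) • u) f := fun u hu f hf =>
    Incomp.degree_nsmul fun k hk => hu k (lt_of_not_ge fun hik => hk (hf k hik))
  refine ⟨fun hu f g hf hg hdeg => ?_, fun hu f g hf hg => ?_⟩
  · have h := (key _ hu f hf).symm
    rw [hdeg] at h
    exact h.trans (key _ hu g hg)
  · have h₁ := key 0 hu f hf
    have h₂ := key 0 hu g hg
    rw [smul_zero] at h₁ h₂
    exact h₁.symm.trans h₂
end

section
/- Let c = 1. The Inc(ℕ)-compatible non-trivial monomial preorders on R₄ are exactly the following and their inverses (where for monomials x^a ≠ x^b, A := {j | a_j ≠ b_j}): (1) ≺_deg: x^a ≺ x^b ⇔ deg(x^a) < deg(x^b); (2) ≺_min: x^a ≺ x^b ⇔ a_{min(A)} < b_{min(A)}; (3) ≺_deg-min: x^a ≺ x^b ⇔ deg(x^a) < deg(x^b), or deg(x^a) = deg(x^b) and a_{min(A)} < b_{min(A)}; (4) ≺_revdeg-min: x^a ≺ x^b ⇔ deg(x^a) > deg(x^b), or deg(x^a) = deg(x^b) and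 a_{min(A)} < b_{min(A)}; (5) ≺_{max,i} for i ∈ [4]: x^a ≺ x^b ⇔ max(A) ≥ i and a_{max(A)} < b_{max(A)}; (6) ≺_{deg-max,i} for i ∈ {2,3,4}: x^a ≺ x^b ⇔ deg(x^a) < deg(x^b), or deg(x^a) = deg(x^b), max(A) ≥ i and a_{max(A)} < b_{max(A)}; (7) ≺_{revdeg-max,i} for i ∈ {2,3,4}: x^a ≺ x^b ⇔ deg(x^a) > deg(x^b), or deg(x^a) = deg(x^b), max(A) ≥ i and a_{max(A)} < b_{max(A)}. -/
/-- The degree of a monomial of `R₄`. -/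
def deg4 (a : Fin 4 → ℕ) : ℕ := ∑ k, a k

/-- (1) `≺_deg`. -/
def degLt4 (a b : Fin 4 → ℕ) : Prop := deg4 a < deg4 b

/-- `a_{min A} < b_{min A}` where `A = {j | a_j ≠ b_j}`. -/
def minLt4 (a b : Fin 4 → ℕ) : Prop := ∃ j : Fin 4, a j < b j ∧ ∀ k < j, a k = b k

/-- (2) `≺_min`. -/
def oMin4 (a b : Fin 4 → ℕ) : Prop := minLt4 a b

/-- (3) `≺_deg-min`. -/
def degMinLt4 (a b : Fin 4 → ℕ) : Prop :=
  deg4 a < deg4 b ∨ (deg4 a = deg4 b ∧ minLt4 a b)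

/-- (4) `≺_revdeg-min`. -/
def revdegMinLt4 (a b : Fin 4 → ℕ) : Prop :=
  deg4 b < deg4 a ∨ (deg4 a = deg4 b ∧ minLt4 a b)

/-- `max A ≥ i` and `a_{max A} < b_{max A}` where `A = {j | a_j ≠ b_j}`
(the threshold `i` is rendered `0`-based, so `i ∈ [4]` becomes `i : Fin 4`). -/
def maxLt4 (i : Fin 4) (a b : Fin 4 → ℕ) : Prop :=
  ∃ j : Fin 4, i ≤ j ∧ a j < b j ∧ ∀ k, j < k → a k = b k

/-- (6) `≺_{deg-max,i}`. -/
def degMaxLt4 (i : Fin 4) (a b : Fin 4 → ℕ) : Prop :=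
  deg4 a < deg4 b ∨ (deg4 a = deg4 b ∧ maxLt4 i a b)

/-- (7) `≺_{revdeg-max,i}`. -/
def revdegMaxLt4 (i : Fin 4) (a b : Fin 4 → ℕ) : Prop :=
  deg4 b < deg4 a ∨ (deg4 a = deg4 b ∧ maxLt4 i a b)



/-! ### The listed relations are compatible monomial preorders -/

/-- A relation pulled back from a linearly ordered cancellative monoid along an additive map is a
monomial preorder. -/
def MonomialPreorder.ofAddHom {n : ℕ} {G : Type*} [AddCommMonoid G] [LinearOrder G]
    [IsOrderedCancelAddMonoid G] (φ : (Fin n → ℕ) →+ G) : MonomialPreorder n where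
  lt a b := φ a < φ b
  irrefl a := lt_irrefl _
  trans a b c := lt_trans
  mul a b h hab := by simpa using hab
  cancel a b h hab := by simpa using hab
  incomp_trans a b c hab hbc := by
    simp only [not_lt] at *
    exact ⟨hab.1.trans' hbc.1, hab.2.trans hbc.2⟩

/-- A relation on exponent vectors which is preserved by all strictly increasing index maps. -/
def IncInvariant (r : (Fin 4 → ℕ) → (Fin 4 → ℕ) → Prop) : Prop :=
  ∀ p : ℕ → ℕ, StrictMono p → ∀ a b : Fin 4 → ℕ,
    (∀ k : Fin 4, a k ≠ 0 → p (k : ℕ) < 4) → (∀ k : Fin 4, b k ≠ 0 → p (k : ℕ) < 4) →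
    r a b → r (pushExp p a) (pushExp p b)

/-- A relation on exponent vectors is realized by an additive map to a linearly ordered
monoid. -/
def HasAddKey (r : (Fin 4 → ℕ) → (Fin 4 → ℕ) → Prop) : Prop :=
  ∃ (G : Type) (_ : AddCommMonoid G) (_ : LinearOrder G) (_ : IsOrderedCancelAddMonoid G)
    (φ : (Fin 4 → ℕ) →+ G), ∀ a b, r a b ↔ φ a < φ b

theorem HasAddKey.exists_monomialPreorder {r : (Fin 4 → ℕ) → (Fin 4 → ℕ) → Prop}
    (h : HasAddKey r) : ∃ T : MonomialPreorder 4, T.lt = r := by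
  obtain ⟨G, _, _, _, φ, hφ⟩ := h
  exact ⟨.ofAddHom φ, by ext a b; exact (hφ a b).symm⟩

theorem HasAddKey.flip {r : (Fin 4 → ℕ) → (Fin 4 → ℕ) → Prop} (h : HasAddKey r) :
    HasAddKey (flip r) := by
  obtain ⟨G, _, _, _, φ, hφ⟩ := h
  exact ⟨Gᵒᵈ, inferInstance, inferInstance, inferInstance,
    ⟨⟨fun a => OrderDual.toDual (φ a), by simp⟩, fun a b => by simp⟩, fun a b => hφ b a⟩

theorem IncInvariant.flip {r : (Fin 4 → ℕ) → (Fin 4 → ℕ) → Prop} (h : IncInvariant r) :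
    IncInvariant (flip r) :=
  fun p hp a b ha hb hab => h p hp b a hb ha hab

theorem deg4_add (a b : Fin 4 → ℕ) : deg4 (a + b) = deg4 a + deg4 b :=
  Finset.sum_add_distrib

theorem deg4_pushExp (p : ℕ → ℕ) (a : Fin 4 → ℕ) (ha : ∀ k : Fin 4, a k ≠ 0 → p (k : ℕ) < 4) :
    deg4 (pushExp p a) = deg4 a := by
  unfold deg4 pushExp
  rw [Finset.sum_comm]
  refine Finset.sum_congr rfl fun k _ => ?_
  by_cases hk : a k = 0
  · simp [hk]
  · rw [Finset.sum_eq_single (⟨p k, ha k hk⟩ : Fin 4)]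
    · simp
    · intro j _ hj
      rw [if_neg]
      rintro h
      exact hj (Fin.ext h.symm)
    · simp

theorem pushExp_apply {p : ℕ → ℕ} (hp : StrictMono p) (a : Fin 4 → ℕ) (k j : Fin 4)
    (hj : p k = j) : pushExp p a j = a k := by
  unfold pushExp
  rw [Finset.sum_eq_single k]
  · simp [hj]
  · intro l _ hl
    rw [if_neg]
    intro h
    exact hl (Fin.ext (hp.injective (h.trans hj.symm)))
  · simp

theorem pushExp_congr {p : ℕ → ℕ} {a b : Fin 4 → ℕ} {j : Fin 4}
    (h : ∀ k : Fin 4, p k = j → a k = b k) : pushExp p a j = pushExp p b j := by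
  unfold pushExp
  refine Finset.sum_congr rfl fun k _ => ?_
  split_ifs with hk
  · exact h k hk
  · rfl

theorem incInvariant_degLt4 : IncInvariant degLt4 := by
  intro p _ a b ha hb h
  rwa [degLt4, deg4_pushExp p a ha, deg4_pushExp p b hb]

theorem incInvariant_minLt4 : IncInvariant minLt4 := by
  rintro p hp a b ha hb ⟨j, hj, h⟩
  refine ⟨⟨p j, hb j (by omega)⟩, ?_, fun k hk => pushExp_congr fun l hl => h l ?_⟩
  · rwa [pushExp_apply hp a j _ rfl, pushExp_apply hp b j _ rfl]
  · rw [Fin.lt_def] at hk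
    exact hp.lt_iff_lt.1 (hl.trans_lt hk)

theorem incInvariant_maxLt4 (i : Fin 4) : IncInvariant (maxLt4 i) := by
  rintro p hp a b ha hb ⟨j, hij, hj, h⟩
  refine ⟨⟨p j, hb j (by omega)⟩, ?_, ?_, fun k hk => pushExp_congr fun l hl => h l ?_⟩
  · exact Fin.le_def.2 ((Fin.le_def.1 hij).trans hp.le_apply)
  · rwa [pushExp_apply hp a j _ rfl, pushExp_apply hp b j _ rfl]
  · rw [Fin.lt_def] at hk
    exact hp.lt_iff_lt.1 (hk.trans_eq hl.symm)

theorem IncInvariant.deg_refine {r : (Fin 4 → ℕ) → (Fin 4 → ℕ) → Prop} (h : IncInvariant r) :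
    IncInvariant (fun a b => deg4 a < deg4 b ∨ (deg4 a = deg4 b ∧ r a b)) := by
  intro p hp a b ha hb hab
  simp only [deg4_pushExp p a ha, deg4_pushExp p b hb]
  exact hab.imp_right fun h' => ⟨h'.1, h p hp a b ha hb h'.2⟩

theorem IncInvariant.revdeg_refine {r : (Fin 4 → ℕ) → (Fin 4 → ℕ) → Prop} (h : IncInvariant r) :
    IncInvariant (fun a b => deg4 b < deg4 a ∨ (deg4 a = deg4 b ∧ r a b)) := by
  intro p hp a b ha hb hab
  simp only [deg4_pushExp p a ha, deg4_pushExp p b hb]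
  exact hab.imp_right fun h' => ⟨h'.1, h p hp a b ha hb h'.2⟩

theorem hasAddKey_degLt4 : HasAddKey degLt4 :=
  ⟨ℕ, inferInstance, inferInstance, inferInstance, ⟨⟨deg4, by simp [deg4]⟩, deg4_add⟩,
    fun _ _ => Iff.rfl⟩

theorem hasAddKey_minLt4 : HasAddKey minLt4 := by
  refine ⟨Lex (Fin 4 → ℕ), inferInstance, inferInstance, inferInstance,
    ⟨⟨fun a => toLex a, rfl⟩, fun _ _ => rfl⟩, fun a b => exists_congr fun j => ?_⟩
  exact and_comm

theorem hasAddKey_maxLt4 (i : Fin 4) : HasAddKey (maxLt4 i) := by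
  refine ⟨Lex (Fin 4 → ℕ), inferInstance, inferInstance, inferInstance,
    ⟨⟨fun a => toLex fun j => if i ≤ j.rev then a j.rev else 0, ?_⟩, fun a b => ?_⟩,
    fun a b => ⟨?_, ?_⟩⟩
  · simp only [Pi.zero_apply, ite_self]
    rfl
  · rw [← toLex_add]
    refine congrArg toLex (funext fun j => ?_)
    simp only [Pi.add_apply]
    split_ifs <;> rfl
  · rintro ⟨j, hij, hj, h⟩
    refine ⟨j.rev, fun k hk => ?_, ?_⟩
    · simp [h k.rev (Fin.lt_rev_iff.1 hk)]
    · simpa [hij] using hj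
  · rintro ⟨j, h, hj⟩
    simp only [AddMonoidHom.coe_mk, ZeroHom.coe_mk, Pi.toLex_apply] at h hj
    have hij : i ≤ j.rev := by
      by_contra hij
      simp [hij] at hj
    refine ⟨j.rev, hij, by simpa [hij] using hj, fun k hk => ?_⟩
    have := h k.rev (Fin.rev_lt_iff.2 hk)
    simpa [hij.trans hk.le] using this

theorem HasAddKey.deg_refine {r : (Fin 4 → ℕ) → (Fin 4 → ℕ) → Prop} (h : HasAddKey r) :
    HasAddKey (fun a b => deg4 a < deg4 b ∨ (deg4 a = deg4 b ∧ r a b)) := by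
  obtain ⟨G, _, _, _, φ, hφ⟩ := h
  refine ⟨ℕ ×ₗ G, inferInstance, inferInstance, inferInstance,
    ⟨⟨fun a => toLex (deg4 a, φ a), by simp [deg4]⟩, fun a b => ?_⟩, fun a b => ?_⟩
  · simp [deg4_add, ← toLex_add]
  · change _ ↔ toLex (deg4 a, φ a) < toLex (deg4 b, φ b)
    simp [Prod.Lex.toLex_lt_toLex, hφ]

theorem HasAddKey.revdeg_refine {r : (Fin 4 → ℕ) → (Fin 4 → ℕ) → Prop} (h : HasAddKey r) :
    HasAddKey (fun a b => deg4 b < deg4 a ∨ (deg4 a = deg4 b ∧ r a b)) := by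
  convert h.flip.deg_refine.flip using 3
  exact or_congr_right (and_congr_left' eq_comm)

theorem HasAddKey.mem_compatible {r : (Fin 4 → ℕ) → (Fin 4 → ℕ) → Prop} (h : HasAddKey r)
    (hinc : IncInvariant r) (hr : ∃ a b, r a b) :
    ∃ T : MonomialPreorder 4, IncCompatible4 T ∧ (∃ a b, T.lt a b) ∧ T.lt = r := by
  obtain ⟨T, rfl⟩ := h.exists_monomialPreorder
  exact ⟨T, hinc, hr, rfl⟩

theorem minLt4_zero_one : minLt4 0 1 := ⟨0, by simp, by simp⟩

theorem maxLt4_zero_one (i : Fin 4) : maxLt4 i 0 1 :=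
  ⟨3, Fin.le_last i, by simp, fun k hk => absurd hk (Fin.le_last k).not_gt⟩

theorem exists_revdeg_refine {r : (Fin 4 → ℕ) → (Fin 4 → ℕ) → Prop} :
    ∃ a b : Fin 4 → ℕ, deg4 b < deg4 a ∨ (deg4 a = deg4 b ∧ r a b) :=
  ⟨1, 0, Or.inl (by simp [deg4])⟩

theorem exists_deg_refine {r : (Fin 4 → ℕ) → (Fin 4 → ℕ) → Prop} :
    ∃ a b : Fin 4 → ℕ, deg4 a < deg4 b ∨ (deg4 a = deg4 b ∧ r a b) :=
  ⟨0, 1, Or.inl (by simp [deg4])⟩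


/-! ### Realization in a linearly ordered group -/

namespace MonomialPreorder

variable {n : ℕ} (T : MonomialPreorder n)

theorem lt_add_right_iff (a b h : Fin n → ℕ) : T.lt (a + h) (b + h) ↔ T.lt a b :=
  ⟨T.cancel a b h, T.mul a b h⟩

theorem lt_iff_of_add_eq_add {a b a' b' : Fin n → ℕ} (h : a + b' = a' + b) :
    T.lt a b ↔ T.lt a' b' := by
  rw [← T.lt_add_right_iff a b b', h, add_comm b b', T.lt_add_right_iff]

/-- The integer vectors `v` for which the monomial of the positive part of `v` is not smaller
than that of the negative part. -/
def Nonneg (v : Fin n → ℤ) : Prop :=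
  ¬ T.lt (fun k => (v k).toNat) (fun k => (-v k).toNat)

theorem nonneg_sub_iff (a b : Fin n → ℕ) :
    T.Nonneg (fun k => (b k : ℤ) - a k) ↔ ¬ T.lt b a := by
  refine not_congr (T.lt_iff_of_add_eq_add ?_)
  funext k
  simp only [Pi.add_apply]
  omega

theorem exists_eq_sub (v : Fin n → ℤ) :
    ∃ a b : Fin n → ℕ, v = fun k => (b k : ℤ) - a k :=
  ⟨fun k => (-v k).toNat, fun k => (v k).toNat, by funext k; simp⟩

theorem not_lt_trans {a b c : Fin n → ℕ} (hab : ¬ T.lt a b) (hbc : ¬ T.lt b c) : ¬ T.lt a c := by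
  intro hac
  by_cases hba : T.lt b a
  · exact hbc (T.trans _ _ _ hba hac)
  · by_cases hcb : T.lt c b
    · exact hab (T.trans _ _ _ hac hcb)
    · exact (T.incomp_trans a b c ⟨hab, hba⟩ ⟨hbc, hcb⟩).1 hac

theorem nonneg_add {v w : Fin n → ℤ} (hv : T.Nonneg v) (hw : T.Nonneg w) : T.Nonneg (v + w) := by
  obtain ⟨a, b, rfl⟩ := exists_eq_sub v
  obtain ⟨c, d, rfl⟩ := exists_eq_sub w
  rw [nonneg_sub_iff] at hv hw
  have key : ¬ T.lt (b + d) (a + c) := by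
    refine T.not_lt_trans (b := a + d) (mt (T.cancel _ _ d) hv) ?_
    rw [add_comm a d, add_comm a c]
    exact mt (T.cancel _ _ a) hw
  rw [← nonneg_sub_iff] at key
  convert key using 1
  funext k
  simp only [Pi.add_apply, Nat.cast_add]
  ring

theorem nonneg_zero : T.Nonneg 0 := T.irrefl _

theorem nonneg_or_nonneg_neg (v : Fin n → ℤ) : T.Nonneg v ∨ T.Nonneg (-v) := by
  by_contra! h
  simp only [Nonneg, not_not, Pi.neg_apply, neg_neg] at h
  exact T.irrefl _ (T.trans _ _ _ h.1 h.2)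

/-- The integer vectors that are neither positive nor negative. -/
def neutral : AddSubgroup (Fin n → ℤ) where
  carrier := {v | T.Nonneg v ∧ T.Nonneg (-v)}
  zero_mem' := ⟨T.nonneg_zero, by simpa using T.nonneg_zero⟩
  add_mem' {v w} hv hw := ⟨T.nonneg_add hv.1 hw.1, by
    rw [neg_add]
    exact T.nonneg_add hv.2 hw.2⟩
  neg_mem' {v} hv := ⟨hv.2, by simpa using hv.1⟩

/-- The cone of nonnegative classes of integer vectors modulo the neutral ones. -/
def cone : AddGroupCone ((Fin n → ℤ) ⧸ T.neutral) where
  carrier := {g | ∃ v : Fin n → ℤ, T.Nonneg v ∧ (v : (Fin n → ℤ) ⧸ T.neutral) = g}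
  zero_mem' := ⟨0, T.nonneg_zero, rfl⟩
  add_mem' := by
    rintro _ _ ⟨v, hv, rfl⟩ ⟨w, hw, rfl⟩
    exact ⟨v + w, T.nonneg_add hv hw, rfl⟩
  eq_zero_of_mem_of_neg_mem' := by
    rintro _ ⟨v, hv, rfl⟩ ⟨w, hw, hwv⟩
    rw [← QuotientAddGroup.mk_neg, QuotientAddGroup.eq] at hwv
    rw [QuotientAddGroup.eq_zero_iff]
    refine ⟨hv, ?_⟩
    have := T.nonneg_add hw hwv.1
    rwa [add_neg_cancel_left] at this

theorem mk_mem_cone_iff (v : Fin n → ℤ) :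
    (v : (Fin n → ℤ) ⧸ T.neutral) ∈ T.cone ↔ T.Nonneg v := by
  refine ⟨?_, fun h => ⟨v, h, rfl⟩⟩
  rintro ⟨w, hw, hwv⟩
  rw [QuotientAddGroup.eq] at hwv
  have := T.nonneg_add hw hwv.1
  rwa [add_neg_cancel_left] at this

theorem exists_linearOrderedGroup : ∃ (G : Type) (_ : AddCommGroup G) (_ : LinearOrder G)
    (_ : IsOrderedAddMonoid G) (x : Fin n → G),
    ∀ a b, T.lt a b ↔ 0 < ∑ k, ((b k : ℤ) - a k) • x k := by
  classical
  have : HasMemOrNegMem T.cone := ⟨fun g => by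
    obtain ⟨v, rfl⟩ := QuotientAddGroup.mk_surjective g
    rw [← QuotientAddGroup.mk_neg, mk_mem_cone_iff, mk_mem_cone_iff]
    exact T.nonneg_or_nonneg_neg v⟩
  let _ : LinearOrder ((Fin n → ℤ) ⧸ T.neutral) := LinearOrder.mkOfAddGroupCone T.cone
  have : IsOrderedAddMonoid ((Fin n → ℤ) ⧸ T.neutral) := IsOrderedAddMonoid.mkOfCone T.cone
  refine ⟨(Fin n → ℤ) ⧸ T.neutral, inferInstance, inferInstance, inferInstance,
    fun k => QuotientAddGroup.mk' T.neutral (Pi.single k 1), fun a b => ?_⟩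
  have hsum : ∑ k, ((b k : ℤ) - a k) • QuotientAddGroup.mk' T.neutral (Pi.single k 1) =
      QuotientAddGroup.mk' T.neutral (fun k => (b k : ℤ) - a k) := by
    simp_rw [← map_zsmul, ← map_sum]
    congr 1
    funext j
    simp [Finset.sum_apply, Pi.single_apply]
  have hle : ∀ g : (Fin n → ℤ) ⧸ T.neutral, g ≤ 0 ↔ 0 - g ∈ T.cone := fun _ => Iff.rfl
  rw [hsum, ← not_le, hle, ← not_iff_not, not_not, ← nonneg_sub_iff, ← mk_mem_cone_iff, zero_sub]
  rw [QuotientAddGroup.mk'_apply, ← QuotientAddGroup.mk_neg]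
  convert Iff.rfl using 3
  funext k
  simp

end MonomialPreorder


/-! ### Domination in linearly ordered groups -/

section OrderedGroup

variable {G : Type*} [AddCommGroup G] [LinearOrder G]

/-- All integer multiples of `x` are smaller than `y`. -/
def Dominated (x y : G) : Prop := ∀ n : ℤ, n • x < y

theorem Dominated.pos {x y : G} (h : Dominated x y) : 0 < y := by
  simpa using h 0

theorem Dominated.zsmul {x y : G} (h : Dominated x y) (m : ℤ) : Dominated (m • x) y := fun n => by
  rw [← mul_smul]
  exact h _

theorem Dominated.neg {x y : G} (h : Dominated x y) : Dominated (-x) y := by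
  simpa using h.zsmul (-1)

theorem dominated_zero {y : G} (hy : 0 < y) : Dominated 0 y := fun n => by simpa

theorem Dominated.trans {x y z : G} (hxy : Dominated x y) (hyz : Dominated y z) :
    Dominated x z := fun n => (hxy n).trans (by simpa using hyz 1)

variable [IsOrderedAddMonoid G]

theorem Dominated.add {x y z : G} (hx : Dominated x z) (hy : Dominated y z) :
    Dominated (x + y) z := fun n => by
  have h : (2 : ℤ) • (n • (x + y)) < (2 : ℤ) • z :=
    calc (2 : ℤ) • (n • (x + y)) = (2 * n) • x + (2 * n) • y := by module
      _ < z + z := add_lt_add (hx _) (hy _)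
      _ = (2 : ℤ) • z := by module
  exact (zsmul_lt_zsmul_iff_right (by norm_num)).1 h

theorem Dominated.sub {x y z : G} (hx : Dominated x z) (hy : Dominated y z) :
    Dominated (x - y) z := by
  rw [sub_eq_add_neg]
  exact hx.add hy.neg

theorem Dominated.of_forall_pos {x y : G} (h : ∀ n : ℤ, 0 < n • x + (1 : ℤ) • y) :
    Dominated x y := fun n => by
  have := h (-n)
  rwa [neg_smul, one_smul, neg_add_eq_sub, sub_pos] at this

theorem Dominated.forall_pos {x y : G} (h : Dominated x y) (n : ℤ) :
    0 < n • x + (1 : ℤ) • y := by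
  have := h (-n)
  rwa [← sub_pos, neg_smul, sub_neg_eq_add, add_comm, ← one_smul ℤ y] at this

theorem Dominated.map {x y x' y' : G} (h : Dominated x y)
    (H : ∀ α β : ℤ, 0 < α • x + β • y → 0 < α • x' + β • y') : Dominated x' y' :=
  .of_forall_pos fun n => H _ _ (h.forall_pos n)

/-- The sign of a combination is determined lexicographically. -/
theorem Dominated.pos_zsmul_add_iff {y w : G} (h : Dominated w y) (c : ℤ) :
    0 < c • y + w ↔ 0 < c ∨ (c = 0 ∧ 0 < w) := by
  have h1 := h 1
  have h2 := h (-1)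
  rw [one_smul] at h1
  rw [neg_one_smul] at h2
  rcases lt_trichotomy c 0 with hc | rfl | hc
  · have : c • y ≤ (-1 : ℤ) • y := zsmul_le_zsmul_left h.pos.le (by omega)
    rw [neg_one_smul] at this
    have hneg : c • y + w < 0 := by
      calc c • y + w < -y + y := add_lt_add_of_le_of_lt this h1
        _ = 0 := by simp
    simp [hneg.le, hc.not_gt, hc.ne]
  · simp
  · have : (1 : ℤ) • y ≤ c • y := zsmul_le_zsmul_left h.pos.le (by omega)
    rw [one_smul] at this
    have hpos : 0 < c • y + w := by
      calc 0 = y + -y := by simp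
        _ < c • y + w := add_lt_add_of_le_of_lt this (neg_lt.1 h2)
    simp [hpos, hc]

theorem pos_zsmul_add_zsmul {u v : G} {α β : ℤ} (hu : 0 < u) (hv : 0 ≤ v) (hα : 0 < α)
    (hβ : 0 ≤ β) : 0 < α • u + β • v :=
  add_pos_of_pos_of_nonneg (zsmul_pos hu hα) (zsmul_nonneg hv hβ)

theorem pos_of_zsmul_pos {x : G} {c : ℤ} (hx : 0 < x) (h : 0 < c • x) : 0 < c := by
  by_contra! hc
  exact h.not_ge (by simpa using zsmul_le_zsmul_left hx.le hc)

/-- Multiples of a bounded element are squeezed between consecutive multiples of `x`. -/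
theorem exists_zsmul_lt_zsmul_le {x y : G} (hx : 0 < x) (hy : 0 < y) {m : ℤ} (hm : y < m • x)
    {N : ℤ} (hN : 0 < N) : ∃ b : ℤ, 0 ≤ b ∧ b • x < N • y ∧ N • y ≤ (b + 1) • x := by
  obtain ⟨b, hb, hmax⟩ := Int.exists_greatest_of_bdd (P := fun b => b • x < N • y)
    ⟨N * m, fun z hz => by
      by_contra! h
      refine hz.not_ge ?_
      calc N • y ≤ N • (m • x) := zsmul_le_zsmul_right hN.le hm.le
        _ = (N * m) • x := by rw [mul_smul]
        _ ≤ z • x := zsmul_le_zsmul_left hx.le h.le⟩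
    ⟨0, by simpa using zsmul_pos hy hN⟩
  refine ⟨b, hmax 0 (by simpa using zsmul_pos hy hN), hb, ?_⟩
  by_contra! h
  have := hmax _ h
  omega

theorem Dominated.exists_of_not {x y : G} (hy : 0 < y) (hx : 0 < x) (h : ¬ Dominated x y) :
    ∃ n : ℤ, 0 < n ∧ y ≤ n • x := by
  simp only [Dominated, not_forall, not_lt] at h
  obtain ⟨n, hn⟩ := h
  exact ⟨n, pos_of_zsmul_pos hx (hy.trans_le hn), hn⟩

end OrderedGroup


/-! ### Shift-invariant sequences in linearly ordered groups -/

section ShiftInvariant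

variable {G : Type*} [AddCommGroup G] [LinearOrder G]

/-- Positivity of combinations of `x₀, x₁, x₂` is preserved by the increasing maps from
`{0, 1, 2}` to `{0, 1, 2, 3}`. -/
structure ShiftInvariant (x₀ x₁ x₂ x₃ : G) : Prop where
  skip_two : ∀ α β γ : ℤ, 0 < α • x₀ + β • x₁ + γ • x₂ → 0 < α • x₀ + β • x₁ + γ • x₃
  skip_one : ∀ α β γ : ℤ, 0 < α • x₀ + β • x₁ + γ • x₂ → 0 < α • x₀ + β • x₂ + γ • x₃
  skip_zero : ∀ α β γ : ℤ, 0 < α • x₀ + β • x₁ + γ • x₂ → 0 < α • x₁ + β • x₂ + γ • x₃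

/-- The property of the consecutive differences of a shift-invariant sequence. -/
structure DiffShiftInvariant (g₁ g₂ g₃ : G) : Prop where
  skip_two : ∀ α β : ℤ, 0 < α • g₁ + β • g₂ → 0 < α • g₁ + β • (g₂ + g₃)
  skip_one : ∀ α β : ℤ, 0 < α • g₁ + β • g₂ → 0 < α • (g₁ + g₂) + β • g₃
  skip_zero : ∀ α β : ℤ, 0 < α • g₁ + β • g₂ → 0 < α • g₂ + β • g₃

theorem ShiftInvariant.diff {x₀ x₁ x₂ x₃ : G} (h : ShiftInvariant x₀ x₁ x₂ x₃) :
    DiffShiftInvariant (x₁ - x₀) (x₂ - x₁) (x₃ - x₂) where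
  skip_two α β hp := by
    convert h.skip_two (-α) (α - β) β (by convert hp using 1; module) using 1
    module
  skip_one α β hp := by
    convert h.skip_one (-α) (α - β) β (by convert hp using 1; module) using 1
    module
  skip_zero α β hp := by
    convert h.skip_zero (-α) (α - β) β (by convert hp using 1; module) using 1
    module

/-- Increasing lexicographic position, where initial entries may vanish. -/
structure IsLexUp (g₁ g₂ g₃ : G) : Prop where
  nonneg : 0 ≤ g₁
  eq_or_dominated : (g₁ = 0 ∧ g₂ = 0) ∨ Dominated g₁ g₂
  dominated₁ : Dominated g₁ g₃
  dominated₂ : Dominated g₂ g₃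

/-- Decreasing lexicographic position. -/
structure IsLexDown (g₁ g₂ g₃ : G) : Prop where
  pos : 0 < g₃
  dominated₂₁ : Dominated g₂ g₁
  dominated₃₁ : Dominated g₃ g₁
  dominated₃₂ : Dominated g₃ g₂

theorem ShiftInvariant.neg [IsOrderedAddMonoid G] {x₀ x₁ x₂ x₃ : G}
    (h : ShiftInvariant x₀ x₁ x₂ x₃) :
    ShiftInvariant (-x₀) (-x₁) (-x₂) (-x₃) where
  skip_two α β γ hp := by simpa using h.skip_two (-α) (-β) (-γ) (by simpa using hp)
  skip_one α β γ hp := by simpa using h.skip_one (-α) (-β) (-γ) (by simpa using hp)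
  skip_zero α β γ hp := by simpa using h.skip_zero (-α) (-β) (-γ) (by simpa using hp)

theorem DiffShiftInvariant.neg [IsOrderedAddMonoid G] {g₁ g₂ g₃ : G}
    (h : DiffShiftInvariant g₁ g₂ g₃) :
    DiffShiftInvariant (-g₁) (-g₂) (-g₃) where
  skip_two α β hp := by
    convert h.skip_two (-α) (-β) (by simpa using hp) using 1
    module
  skip_one α β hp := by
    convert h.skip_one (-α) (-β) (by simpa using hp) using 1
    module
  skip_zero α β hp := by simpa using h.skip_zero (-α) (-β) (by simpa using hp)

namespace DiffShiftInvariant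

variable {g₁ g₂ g₃ : G} (h : DiffShiftInvariant g₁ g₂ g₃)

include h

theorem pos₂ (hg : 0 < g₁) : 0 < g₂ := by
  simpa using h.skip_zero 1 0 (by simpa using hg)

theorem pos₃ (hg : 0 < g₂) : 0 < g₃ := by
  simpa using h.skip_zero 0 1 (by simpa using hg)

variable [IsOrderedAddMonoid G]

theorem dominated_of_le (hg : 0 < g₁) {m : ℤ} (hm : g₂ < m • g₁) : Dominated g₂ g₁ := by
  have hg₂ := h.pos₂ hg
  by_contra hdom
  obtain ⟨n, hn, hgn⟩ := Dominated.exists_of_not hg hg₂ hdom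
  have hN : 0 < n * (2 * n + 2) := by positivity
  obtain ⟨b, hb, hlt, hle⟩ := exists_zsmul_lt_zsmul_le hg hg₂ hm hN
  set N := n * (2 * n + 2) with hNdef
  have hb1 : 2 * n + 2 ≤ b + 1 := by
    have h1 : N • g₁ ≤ (n * (b + 1)) • g₁ :=
      calc N • g₁ ≤ N • (n • g₂) := zsmul_le_zsmul_right hN.le hgn
        _ = n • (N • g₂) := by module
        _ ≤ n • ((b + 1) • g₁) := zsmul_le_zsmul_right hn.le hle
        _ = (n * (b + 1)) • g₁ := by module
    have h2 := (zsmul_le_zsmul_iff_left hg).1 h1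
    exact le_of_mul_le_mul_left h2 hn
  have hlt' : 0 < (-b) • g₁ + N • g₂ := by
    rw [neg_smul, neg_add_eq_sub]
    exact sub_pos.2 hlt
  have hgt' : 0 < (b + 2) • g₁ + (-N) • g₂ := by
    rw [neg_smul, ← sub_eq_add_neg]
    exact sub_pos.2 (hle.trans_lt (zsmul_lt_zsmul_left hg (by omega)))
  have e1 := h.skip_two _ _ hgt'
  have e2 := h.skip_zero _ _ hlt'
  have e3 : 0 < (N * (b + 2) - N * b - b * b) • g₁ := by
    have h1 := pos_zsmul_add_zsmul e1 e2.le hN hN.le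
    have h2 := pos_zsmul_add_zsmul h1 hlt'.le one_pos (add_nonneg hN.le hb)
    convert h2 using 1
    module
  have e4 := pos_of_zsmul_pos hg e3
  nlinarith

theorem isLex_of_pos (hg : 0 < g₁) : IsLexUp g₁ g₂ g₃ ∨ IsLexDown g₁ g₂ g₃ := by
  have hg₂ := h.pos₂ hg
  have hg₃ := h.pos₃ hg₂
  by_cases hdom : Dominated g₁ g₂
  · have h23 := hdom.map h.skip_zero
    exact .inl ⟨hg.le, .inr hdom, hdom.trans h23, h23⟩
  · obtain ⟨m, hm, hle⟩ := Dominated.exists_of_not hg₂ hg hdom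
    have h21 : Dominated g₂ g₁ := h.dominated_of_le hg (m := m + 1)
      (hle.trans_lt (zsmul_lt_zsmul_left hg (by omega)))
    have h32 : Dominated g₃ g₂ := h21.map fun α β hp => by
      rw [add_comm] at hp ⊢
      exact h.skip_zero β α hp
    exact .inr ⟨hg₃, h21, h32.trans h21, h32⟩

theorem isLexUp_of_eq_zero (hg₁ : g₁ = 0) (hg : 0 < g₂) : IsLexUp g₁ g₂ g₃ := by
  subst hg₁
  have hdom := dominated_zero hg
  have h23 := hdom.map h.skip_zero
  exact ⟨le_rfl, .inr hdom, hdom.trans h23, h23⟩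

theorem trichotomy : (g₁ = 0 ∧ g₂ = 0 ∧ g₃ = 0) ∨
    (IsLexUp g₁ g₂ g₃ ∨ IsLexDown g₁ g₂ g₃) ∨
    (IsLexUp (-g₁) (-g₂) (-g₃) ∨ IsLexDown (-g₁) (-g₂) (-g₃)) := by
  rcases lt_trichotomy g₁ 0 with h1 | h1 | h1
  · exact .inr (.inr (h.neg.isLex_of_pos (neg_pos.2 h1)))
  · rcases lt_trichotomy g₂ 0 with h2 | h2 | h2
    · exact .inr (.inr (.inl (h.neg.isLexUp_of_eq_zero (neg_eq_zero.2 h1) (neg_pos.2 h2))))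
    · rcases lt_trichotomy g₃ 0 with h3 | h3 | h3
      · refine .inr (.inr (.inl ?_))
        have hdom := dominated_zero (neg_pos.2 h3)
        rw [h1, h2, neg_zero]
        exact ⟨le_rfl, .inl ⟨rfl, rfl⟩, hdom, hdom⟩
      · exact .inl ⟨h1, h2, h3⟩
      · refine .inr (.inl (.inl ?_))
        have hdom := dominated_zero h3
        rw [h1, h2]
        exact ⟨le_rfl, .inl ⟨rfl, rfl⟩, hdom, hdom⟩
    · exact .inr (.inl (.inl (h.isLexUp_of_eq_zero h1 h2)))
  · exact .inr (.inl (h.isLex_of_pos h1))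

end DiffShiftInvariant

namespace ShiftInvariant

variable {x₀ x₁ x₂ x₃ : G} (h : ShiftInvariant x₀ x₁ x₂ x₃)

include h

theorem map_01_02 (α β : ℤ) (hp : 0 < α • x₀ + β • x₁) : 0 < α • x₀ + β • x₂ := by
  simpa using h.skip_one α β 0 (by simpa using hp)

theorem map_01_12 (α β : ℤ) (hp : 0 < α • x₀ + β • x₁) : 0 < α • x₁ + β • x₂ := by
  simpa using h.skip_zero α β 0 (by simpa using hp)

theorem map_02_03 (α β : ℤ) (hp : 0 < α • x₀ + β • x₂) : 0 < α • x₀ + β • x₃ := by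
  simpa using h.skip_two α 0 β (by simpa using hp)

theorem map_12_13 (α β : ℤ) (hp : 0 < α • x₁ + β • x₂) : 0 < α • x₁ + β • x₃ := by
  simpa using h.skip_two 0 α β (by simpa using hp)

theorem map_12_23 (α β : ℤ) (hp : 0 < α • x₁ + β • x₂) : 0 < α • x₂ + β • x₃ := by
  simpa using h.skip_zero 0 α β (by simpa using hp)

theorem pos₁ (hx : 0 < x₀) : 0 < x₁ := by
  simpa using h.map_01_12 1 0 (by simpa using hx)

theorem pos₂ (hx : 0 < x₁) : 0 < x₂ := by
  simpa using h.map_12_23 1 0 (by simpa using hx)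

theorem pos₃ (hx : 0 < x₂) : 0 < x₃ := by
  simpa using h.map_02_03 0 1 (by simpa using hx)

variable [IsOrderedAddMonoid G]

/-- If `x₀` and `x₁` are comparable in size, then they are infinitesimally close. -/
theorem dominated_sub (hx : 0 < x₀) {m n : ℤ} (hm : x₁ < m • x₀) (hn : 0 < n)
    (hxn : x₀ ≤ n • x₁) : Dominated (x₁ - x₀) x₀ := by
  have hx₁ := h.pos₁ hx
  have key : ∀ N : ℤ, 0 < N → ∃ b : ℤ, 0 ≤ b ∧ b • x₀ < N • x₁ ∧ N • x₁ ≤ (b + 1) • x₀ ∧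
      N ≤ n * (b + 1) ∧ b * b < N * (b + 2) ∧ N * b < (b + 2) * (b + 2) := by
    intro N hN
    obtain ⟨b, hb, hlt, hle⟩ := exists_zsmul_lt_zsmul_le hx hx₁ hm hN
    have hlt' : 0 < (-b) • x₀ + N • x₁ := by
      rw [neg_smul, neg_add_eq_sub]
      exact sub_pos.2 hlt
    have hgt' : 0 < (b + 2) • x₀ + (-N) • x₁ := by
      rw [neg_smul, ← sub_eq_add_neg]
      exact sub_pos.2 (hle.trans_lt (zsmul_lt_zsmul_left hx (by omega)))
    refine ⟨b, hb, hlt, hle, ?_, ?_, ?_⟩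
    · have h1 : N • x₀ ≤ (n * (b + 1)) • x₀ :=
        calc N • x₀ ≤ N • (n • x₁) := zsmul_le_zsmul_right hN.le hxn
          _ = n • (N • x₁) := by module
          _ ≤ n • ((b + 1) • x₀) := zsmul_le_zsmul_right hn.le hle
          _ = (n * (b + 1)) • x₀ := by module
      exact (zsmul_le_zsmul_iff_left hx).1 h1
    · have h1 := pos_zsmul_add_zsmul (h.map_01_02 _ _ hgt') (h.map_01_12 _ _ hlt').le hN hN.le
      have h2 := pos_zsmul_add_zsmul h1 hlt'.le one_pos hb
      refine sub_pos.1 (pos_of_zsmul_pos hx ?_)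
      convert h2 using 1
      module
    · have h1 := pos_zsmul_add_zsmul (h.map_01_02 _ _ hlt') (h.map_01_12 _ _ hgt').le hN hN.le
      have h2 := pos_zsmul_add_zsmul h1 hgt'.le one_pos (show 0 ≤ b + 2 by omega)
      refine sub_pos.1 (pos_of_zsmul_pos hx ?_)
      convert h2 using 1
      module
  intro k
  by_contra! hk
  rcases lt_trichotomy k 0 with hk0 | rfl | hk0
  · obtain ⟨j, rfl⟩ : ∃ j, k = -j := ⟨-k, by simp⟩
    have hj : 0 < j := by omega
    obtain ⟨b, hb, hlt, -, hnb, -, hbN⟩ := key (j * (n + 7)) (by positivity)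
    have h1 : j • x₁ ≤ (j - 1) • x₀ := by
      have := sub_nonneg.2 hk
      refine sub_nonneg.1 ?_
      convert this using 1
      module
    have h2 : (j * b) • x₀ < (j * (n + 7) * (j - 1)) • x₀ :=
      calc (j * b) • x₀ = j • (b • x₀) := by module
        _ < j • ((j * (n + 7)) • x₁) := zsmul_lt_zsmul_right hj hlt
        _ = (j * (n + 7)) • (j • x₁) := by module
        _ ≤ (j * (n + 7)) • ((j - 1) • x₀) := zsmul_le_zsmul_right (by positivity) h1
        _ = (j * (n + 7) * (j - 1)) • x₀ := by module
    have h3 := (zsmul_lt_zsmul_iff_left hx).1 h2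
    rw [mul_assoc] at h3
    have h4 : b < (n + 7) * (j - 1) := lt_of_mul_lt_mul_left h3 hj.le
    have h5 : b < 1 := by nlinarith
    obtain rfl : b = 0 := by omega
    nlinarith
  · simp at hk
    exact hk.not_gt hx
  · obtain ⟨b, hb, -, hle, -, hbN, -⟩ := key (4 * k) (by positivity)
    have h1 : (k + 1) • x₀ ≤ k • x₁ := by
      have := sub_nonneg.2 hk
      refine sub_nonneg.1 ?_
      convert this using 1
      module
    have h2 : (4 * (k + 1)) • x₀ ≤ (b + 1) • x₀ :=
      calc (4 * (k + 1)) • x₀ = (4 : ℤ) • ((k + 1) • x₀) := by module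
        _ ≤ (4 : ℤ) • (k • x₁) := zsmul_le_zsmul_right (by norm_num) h1
        _ = (4 * k) • x₁ := by module
        _ ≤ (b + 1) • x₀ := hle
    have h3 := (zsmul_le_zsmul_iff_left hx).1 h2
    nlinarith

end ShiftInvariant

end ShiftInvariant


/-! ### Identification of the relations -/

theorem minLt4_iff (a b : Fin 4 → ℕ) : minLt4 a b ↔ a 0 < b 0 ∨ (a 0 = b 0 ∧ a 1 < b 1) ∨
    (a 0 = b 0 ∧ a 1 = b 1 ∧ a 2 < b 2) ∨
    (a 0 = b 0 ∧ a 1 = b 1 ∧ a 2 = b 2 ∧ a 3 < b 3) := by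
  simp [minLt4, Fin.exists_fin_succ, Fin.forall_fin_succ]
  omega

theorem maxLt4_iff (i : Fin 4) (a b : Fin 4 → ℕ) : maxLt4 i a b ↔
    a 3 < b 3 ∨ (i ≤ 2 ∧ a 3 = b 3 ∧ a 2 < b 2) ∨
    (i ≤ 1 ∧ a 3 = b 3 ∧ a 2 = b 2 ∧ a 1 < b 1) ∨
    (i ≤ 0 ∧ a 3 = b 3 ∧ a 2 = b 2 ∧ a 1 = b 1 ∧ a 0 < b 0) := by
  fin_cases i <;> simp [maxLt4, Fin.exists_fin_succ, Fin.forall_fin_succ] <;> omega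

theorem deg4_eq (a : Fin 4 → ℕ) : deg4 a = a 0 + a 1 + a 2 + a 3 := by
  simp [deg4, Fin.sum_univ_four]

/-- The relations in the classification. -/
def IsListed (r : (Fin 4 → ℕ) → (Fin 4 → ℕ) → Prop) : Prop :=
  r = degLt4 ∨ r = flip degLt4 ∨
    r = oMin4 ∨ r = flip oMin4 ∨
    r = degMinLt4 ∨ r = flip degMinLt4 ∨
    r = revdegMinLt4 ∨ r = flip revdegMinLt4 ∨
    (∃ i : Fin 4, r = maxLt4 i ∨ r = flip (maxLt4 i)) ∨
    (∃ i : Fin 4, i ≠ 0 ∧ (r = degMaxLt4 i ∨ r = flip (degMaxLt4 i) ∨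
      r = revdegMaxLt4 i ∨ r = flip (revdegMaxLt4 i)))

theorem IsListed.of_flip {r : (Fin 4 → ℕ) → (Fin 4 → ℕ) → Prop} (h : IsListed (flip r)) :
    IsListed r := by
  have key : ∀ s, flip r = s → r = flip s := by
    rintro s rfl
    rfl
  rcases h with h | h | h | h | h | h | h | h | ⟨i, h | h⟩ | ⟨i, hi, h | h | h | h⟩ <;>
    rcases key _ h with rfl <;> unfold IsListed <;> simp [flip_flip] <;> grind

section OrderedGroup

variable {G : Type*} [AddCommGroup G] [LinearOrder G] [IsOrderedAddMonoid G]

theorem IsLexUp.pos_iff {g₁ g₂ g₃ : G} (h : IsLexUp g₁ g₂ g₃) :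
    ∃ i : Fin 4, i ≠ 0 ∧ ∀ c₁ c₂ c₃ : ℤ, 0 < c₁ • g₁ + c₂ • g₂ + c₃ • g₃ ↔
      0 < c₃ ∨ (i ≤ 2 ∧ c₃ = 0 ∧ 0 < c₂) ∨ (i ≤ 1 ∧ c₃ = 0 ∧ c₂ = 0 ∧ 0 < c₁) := by
  have key : ∀ c₁ c₂ c₃ : ℤ, 0 < c₁ • g₁ + c₂ • g₂ + c₃ • g₃ ↔
      0 < c₃ ∨ (c₃ = 0 ∧ 0 < c₂ • g₂ + c₁ • g₁) := fun c₁ c₂ c₃ => by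
    rw [← ((h.dominated₂.zsmul c₂).add (h.dominated₁.zsmul c₁)).pos_zsmul_add_iff]
    abel_nf
  rcases h.eq_or_dominated with ⟨h1, h2⟩ | h12
  · refine ⟨3, by decide, fun c₁ c₂ c₃ => ?_⟩
    rw [key, h1, h2]
    simp
  · rcases h.nonneg.eq_or_lt with h1 | h1
    · refine ⟨2, by decide, fun c₁ c₂ c₃ => ?_⟩
      rw [key, (h12.zsmul c₁).pos_zsmul_add_iff, ← h1]
      simp
    · refine ⟨1, by decide, fun c₁ c₂ c₃ => ?_⟩
      rw [key, (h12.zsmul c₁).pos_zsmul_add_iff, smul_pos_iff_of_pos_right h1]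
      simp
      tauto

theorem IsLexDown.pos_iff {g₁ g₂ g₃ : G} (h : IsLexDown g₁ g₂ g₃) (c₁ c₂ c₃ : ℤ) :
    0 < c₁ • g₁ + c₂ • g₂ + c₃ • g₃ ↔
      0 < c₁ ∨ (c₁ = 0 ∧ 0 < c₂) ∨ (c₁ = 0 ∧ c₂ = 0 ∧ 0 < c₃) := by
  rw [add_assoc, ((h.dominated₂₁.zsmul c₂).add (h.dominated₃₁.zsmul c₃)).pos_zsmul_add_iff,
    (h.dominated₃₂.zsmul c₃).pos_zsmul_add_iff, smul_pos_iff_of_pos_right h.pos]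
  tauto

variable {r : (Fin 4 → ℕ) → (Fin 4 → ℕ) → Prop} {x : Fin 4 → G}

theorem isListed_of_infinitesimal_diff
    (hr : ∀ a b, r a b ↔ 0 < ∑ k, ((b k : ℤ) - a k) • x k)
    (h : DiffShiftInvariant (x 1 - x 0) (x 2 - x 1) (x 3 - x 2))
    (h1 : Dominated (x 1 - x 0) (x 0)) (h2 : Dominated (x 2 - x 1) (x 0))
    (h3 : Dominated (x 3 - x 2) (x 0)) : IsListed r := by
  have key : ∀ a b, r a b ↔ deg4 a < deg4 b ∨ (deg4 a = deg4 b ∧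
      0 < ((b 1 : ℤ) - a 1 + (b 2 - a 2) + (b 3 - a 3)) • (x 1 - x 0) +
        ((b 2 : ℤ) - a 2 + (b 3 - a 3)) • (x 2 - x 1) + ((b 3 : ℤ) - a 3) • (x 3 - x 2)) := by
    intro a b
    have hd : (0 < (deg4 b : ℤ) - deg4 a ↔ deg4 a < deg4 b) ∧
      ((deg4 b : ℤ) - deg4 a = 0 ↔ deg4 a = deg4 b) := by omega
    rw [hr, ← hd.1, ← hd.2, ← (((h1.zsmul _).add (h2.zsmul _)).add (h3.zsmul _)).pos_zsmul_add_iff,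
      Fin.sum_univ_four, deg4_eq, deg4_eq]
    push_cast
    refine iff_of_eq (congrArg _ ?_)
    module
  rcases h.trichotomy with ⟨e1, e2, e3⟩ | (hl | hl) | hl | hl
  · left
    ext a b
    rw [key, e1, e2, e3]
    simp [degLt4]
  · obtain ⟨i, hi, hpos⟩ := hl.pos_iff
    have : r = degMaxLt4 i := by
      ext a b
      rw [key, hpos, degMaxLt4, maxLt4_iff, deg4_eq, deg4_eq]
      omega
    unfold IsListed
    grind
  · have : r = flip revdegMinLt4 := by
      ext a b
      rw [key, hl.pos_iff, flip, revdegMinLt4, minLt4_iff, deg4_eq, deg4_eq]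
      omega
    unfold IsListed
    grind
  · obtain ⟨i, hi, hpos⟩ := hl.pos_iff
    have : r = flip (revdegMaxLt4 i) := by
      ext a b
      rw [key, ← neg_smul_neg, ← neg_smul_neg _ (x 2 - x 1), ← neg_smul_neg _ (x 3 - x 2), hpos,
        flip, revdegMaxLt4, maxLt4_iff, deg4_eq, deg4_eq]
      omega
    unfold IsListed
    grind
  · have : r = degMinLt4 := by
      ext a b
      rw [key, ← neg_smul_neg, ← neg_smul_neg _ (x 2 - x 1), ← neg_smul_neg _ (x 3 - x 2),
        hl.pos_iff, degMinLt4, minLt4_iff, deg4_eq, deg4_eq]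
      omega
    unfold IsListed
    grind

theorem isListed_of_dominated (hr : ∀ a b, r a b ↔ 0 < ∑ k, ((b k : ℤ) - a k) • x k)
    (h : ShiftInvariant (x 0) (x 1) (x 2) (x 3)) (hx : 0 ≤ x 0) (h01 : Dominated (x 0) (x 1)) :
    IsListed r := by
  have h12 := h01.map h.map_01_12
  have h23 := h12.map h.map_12_23
  have key : ∀ a b, r a b ↔ 0 < ((b 3 : ℤ) - a 3) • x 3 + (((b 2 : ℤ) - a 2) • x 2 +
      (((b 1 : ℤ) - a 1) • x 1 + ((b 0 : ℤ) - a 0) • x 0)) := by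
    intro a b
    rw [hr, Fin.sum_univ_four]
    refine iff_of_eq (congrArg _ ?_)
    abel
  have h02 := h01.trans h12
  have hpos : ∀ a b, r a b ↔ a 3 < b 3 ∨ (a 3 = b 3 ∧ (a 2 < b 2 ∨ (a 2 = b 2 ∧
      (a 1 < b 1 ∨ (a 1 = b 1 ∧ 0 < ((b 0 : ℤ) - a 0) • x 0))))) := by
    intro a b
    rw [key, ((h23.zsmul _).add (((h12.trans h23).zsmul _).add
      ((h02.trans h23).zsmul _))).pos_zsmul_add_iff,
      ((h12.zsmul _).add (h02.zsmul _)).pos_zsmul_add_iff, (h01.zsmul _).pos_zsmul_add_iff]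
    grind
  rcases hx.eq_or_lt with hx | hx
  · have : r = maxLt4 1 := by
      ext a b
      rw [hpos, maxLt4_iff, ← hx]
      simp
      grind
    unfold IsListed
    grind
  · have : r = maxLt4 0 := by
      ext a b
      rw [hpos, maxLt4_iff, smul_pos_iff_of_pos_right hx]
      simp
      grind
    unfold IsListed
    grind

theorem isListed_of_pos (hr : ∀ a b, r a b ↔ 0 < ∑ k, ((b k : ℤ) - a k) • x k)
    (h : ShiftInvariant (x 0) (x 1) (x 2) (x 3)) (hx : 0 < x 0) : IsListed r := by
  have hx₁ := h.pos₁ hx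
  have hx₃ := h.pos₃ (h.pos₂ hx₁)
  by_cases h01 : Dominated (x 0) (x 1)
  · exact isListed_of_dominated hr h hx.le h01
  obtain ⟨m, hm, hle⟩ := Dominated.exists_of_not hx₁ hx h01
  by_cases h10 : Dominated (x 1) (x 0)
  · have h20 : Dominated (x 2) (x 0) := h10.map fun α β hp => by
      rw [add_comm] at hp ⊢
      exact h.map_01_02 β α hp
    have h30 : Dominated (x 3) (x 0) := h20.map fun α β hp => by
      rw [add_comm] at hp ⊢
      exact h.map_02_03 β α hp
    have h21 : Dominated (x 2) (x 1) := h10.map fun α β hp => by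
      rw [add_comm] at hp ⊢
      exact h.map_01_12 β α hp
    have h31 : Dominated (x 3) (x 1) := h21.map fun α β hp => by
      rw [add_comm] at hp ⊢
      exact h.map_12_13 β α hp
    have h32 : Dominated (x 3) (x 2) := h21.map fun α β hp => by
      rw [add_comm] at hp ⊢
      exact h.map_12_23 β α hp
    have : r = oMin4 := by
      ext a b
      rw [hr, Fin.sum_univ_four, add_assoc, add_assoc,
        ((h10.zsmul _).add ((h20.zsmul _).add (h30.zsmul _))).pos_zsmul_add_iff,
        ((h21.zsmul _).add (h31.zsmul _)).pos_zsmul_add_iff, (h32.zsmul _).pos_zsmul_add_iff,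
        smul_pos_iff_of_pos_right hx₃, oMin4, minLt4_iff]
      omega
    unfold IsListed
    grind
  · obtain ⟨n, hn, hxn⟩ := Dominated.exists_of_not hx hx₁ h10
    have d1 : Dominated (x 1 - x 0) (x 0) :=
      h.dominated_sub hx (hle.trans_lt (zsmul_lt_zsmul_left hx (lt_add_one m))) hn hxn
    have d2 : Dominated (x 2 - x 0) (x 0) := d1.map fun α β hp => by
      convert h.map_01_02 (β - α) α (by convert hp using 1; module) using 1
      module
    have d3 : Dominated (x 3 - x 0) (x 0) := d2.map fun α β hp => by
      convert h.map_02_03 (β - α) α (by convert hp using 1; module) using 1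
      module
    refine isListed_of_infinitesimal_diff hr h.diff d1 ?_ ?_
    · simpa using d2.sub d1
    · simpa using d3.sub d2

theorem isListed_of_nonneg (hr : ∀ a b, r a b ↔ 0 < ∑ k, ((b k : ℤ) - a k) • x k)
    (h : ShiftInvariant (x 0) (x 1) (x 2) (x 3)) {i : Fin 4} (hi : 0 < x i)
    (hlt : ∀ k < i, x k = 0) : IsListed r := by
  obtain rfl | rfl | rfl | rfl : i = 0 ∨ i = 1 ∨ i = 2 ∨ i = 3 := by fin_cases i <;> simp
  · exact isListed_of_pos hr h hi
  · have h0 : x 0 = 0 := hlt 0 (by decide)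
    refine isListed_of_dominated hr h h0.ge ?_
    rw [h0]
    exact dominated_zero hi
  · have h0 : x 0 = 0 := hlt 0 (by decide)
    have h1 : x 1 = 0 := hlt 1 (by decide)
    have h12 : Dominated (x 1) (x 2) := by
      rw [h1]
      exact dominated_zero hi
    have h23 := h12.map h.map_12_23
    have : r = maxLt4 2 := by
      ext a b
      rw [hr, Fin.sum_univ_four, h0, h1, smul_zero, smul_zero, zero_add, zero_add, add_comm,
        (h23.zsmul _).pos_zsmul_add_iff, smul_pos_iff_of_pos_right hi, maxLt4_iff]
      simp
      omega
    unfold IsListed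
    grind
  · have : r = maxLt4 3 := by
      ext a b
      rw [hr, Fin.sum_univ_four, hlt 0 (by decide), hlt 1 (by decide), hlt 2 (by decide),
        smul_zero, smul_zero, smul_zero, zero_add, zero_add, zero_add,
        smul_pos_iff_of_pos_right hi, maxLt4_iff]
      simp
    unfold IsListed
    grind

theorem isListed_of_shiftInvariant (hr : ∀ a b, r a b ↔ 0 < ∑ k, ((b k : ℤ) - a k) • x k)
    (h : ShiftInvariant (x 0) (x 1) (x 2) (x 3)) (hne : ∃ a b, r a b) : IsListed r := by
  have hx : ∃ i, x i ≠ 0 := by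
    by_contra! hx
    obtain ⟨a, b, hab⟩ := hne
    simp [hr, hx] at hab
  obtain ⟨i, hi, hmin⟩ := WellFounded.has_min wellFounded_lt {i | x i ≠ 0} hx
  have hlt : ∀ k < i, x k = 0 := fun k hk => by
    by_contra hk0
    exact hmin k hk0 hk
  rcases lt_or_gt_of_ne hi with hi | hi
  · refine IsListed.of_flip (isListed_of_nonneg (x := fun k => -x k) (fun a b => ?_) h.neg
      (neg_pos.2 hi) fun k hk => by simp [hlt k hk])
    rw [flip, hr]
    refine iff_of_eq (congrArg _ (Finset.sum_congr rfl fun k _ => ?_))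
    module
  · exact isListed_of_nonneg hr h hi hlt

end OrderedGroup

theorem IncCompatible4.lt_pushExp_skip {T : MonomialPreorder 4} (hT : IncCompatible4 T)
    (s : ℕ) {a b : Fin 4 → ℕ} (ha : a 3 = 0) (hb : b 3 = 0) (hab : T.lt a b) :
    T.lt (pushExp (fun n => if n < s then n else n + 1) a)
      (pushExp (fun n => if n < s then n else n + 1) b) := by
  have key : ∀ c : Fin 4 → ℕ, c 3 = 0 → ∀ k : Fin 4, c k ≠ 0 →
      (fun n => if n < s then n else n + 1) (k : ℕ) < 4 := by
    intro c hc k hk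
    have : k ≠ 3 := by
      rintro rfl
      exact hk hc
    have : (k : ℕ) ≠ 3 := fun h => this (Fin.ext h)
    dsimp only
    split_ifs <;> omega
  refine hT _ ?_ a b (key a ha) (key b hb) hab
  intro m n hmn
  dsimp only
  split_ifs <;> omega

theorem IncCompatible4.shiftInvariant {G : Type*} [AddCommGroup G] [LinearOrder G]
    {T : MonomialPreorder 4} (hT : IncCompatible4 T) {x : Fin 4 → G}
    (hx : ∀ a b, T.lt a b ↔ 0 < ∑ k, ((b k : ℤ) - a k) • x k) :
    ShiftInvariant (x 0) (x 1) (x 2) (x 3) := by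
  have key : ∀ (s : ℕ) (α β γ : ℤ), 0 < α • x 0 + β • x 1 + γ • x 2 →
      T.lt (pushExp (fun n => if n < s then n else n + 1)
          ![(-α).toNat, (-β).toNat, (-γ).toNat, 0])
        (pushExp (fun n => if n < s then n else n + 1) ![α.toNat, β.toNat, γ.toNat, 0]) := by
    intro s α β γ hp
    refine hT.lt_pushExp_skip s rfl rfl ((hx _ _).2 ?_)
    simpa [Fin.sum_univ_four] using hp
  constructor
  · intro α β γ hp
    simpa [hx, Fin.sum_univ_four, pushExp] using key 2 α β γ hp
  · intro α β γ hp
    simpa [hx, Fin.sum_univ_four, pushExp] using key 1 α β γ hp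
  · intro α β γ hp
    simpa [hx, Fin.sum_univ_four, pushExp] using key 0 α β γ hp

theorem IsListed.mem_compatible {r : (Fin 4 → ℕ) → (Fin 4 → ℕ) → Prop} (h : IsListed r) :
    ∃ T : MonomialPreorder 4, IncCompatible4 T ∧ (∃ a b, T.lt a b) ∧ T.lt = r := by
  have key : ∀ s, HasAddKey s → IncInvariant s → (∃ a b, s a b) → (r = s ∨ r = flip s) →
      ∃ T : MonomialPreorder 4, IncCompatible4 T ∧ (∃ a b, T.lt a b) ∧ T.lt = r := by
    rintro s hs hinc ⟨a, b, hab⟩ (rfl | rfl)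
    · exact hs.mem_compatible hinc ⟨a, b, hab⟩
    · exact hs.flip.mem_compatible hinc.flip ⟨b, a, hab⟩
  have hdeg := key _ hasAddKey_degLt4 incInvariant_degLt4 ⟨0, 1, by simp [degLt4, deg4]⟩
  have hmin := key _ hasAddKey_minLt4 incInvariant_minLt4 ⟨0, 1, minLt4_zero_one⟩
  have hdegmin := key _ hasAddKey_minLt4.deg_refine incInvariant_minLt4.deg_refine
    exists_deg_refine
  have hrevdegmin := key _ hasAddKey_minLt4.revdeg_refine incInvariant_minLt4.revdeg_refine
    exists_revdeg_refine
  have hmax := fun i => key _ (hasAddKey_maxLt4 i) (incInvariant_maxLt4 i)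
    ⟨0, 1, maxLt4_zero_one i⟩
  have hdegmax := fun i => key _ (hasAddKey_maxLt4 i).deg_refine (incInvariant_maxLt4 i).deg_refine
    exists_deg_refine
  have hrevdegmax := fun i => key _ (hasAddKey_maxLt4 i).revdeg_refine
    (incInvariant_maxLt4 i).revdeg_refine exists_revdeg_refine
  rcases h with h | h | h | h | h | h | h | h | ⟨i, h⟩ | ⟨i, -, h | h | h | h⟩
  · exact hdeg (.inl h)
  · exact hdeg (.inr h)
  · exact hmin (.inl h)
  · exact hmin (.inr h)
  · exact hdegmin (.inl h)
  · exact hdegmin (.inr h)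
  · exact hrevdegmin (.inl h)
  · exact hrevdegmin (.inr h)
  · exact hmax i h
  · exact hdegmax i (.inl h)
  · exact hdegmax i (.inr h)
  · exact hrevdegmax i (.inl h)
  · exact hrevdegmax i (.inr h)


/-- **Proposition (Statement 17).** The `Inc(ℕ)`-compatible non-trivial monomial preorders
on `R₄` (for `c = 1`) are exactly: `≺_deg`, `≺_min`, `≺_deg-min`, `≺_revdeg-min`,
`≺_{max,i}` for `i ∈ [4]`, `≺_{deg-max,i}` and `≺_{revdeg-max,i}` for `i ∈ {2,3,4}`,
and their inverses.  (The paper's `1`-based thresholds `i ∈ [4]` resp. `i ∈ {2,3,4}`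
are rendered `0`-based as `i : Fin 4` resp. `i : Fin 4` with `i ≠ 0`.) -/
theorem incCompatible_monomialPreorders_classification :
    {r : (Fin 4 → ℕ) → (Fin 4 → ℕ) → Prop |
        ∃ T : MonomialPreorder 4, IncCompatible4 T ∧ (∃ a b, T.lt a b) ∧ T.lt = r} =
      {r | r = degLt4 ∨ r = flip degLt4 ∨
        r = oMin4 ∨ r = flip oMin4 ∨
        r = degMinLt4 ∨ r = flip degMinLt4 ∨
        r = revdegMinLt4 ∨ r = flip revdegMinLt4 ∨
        (∃ i : Fin 4, r = maxLt4 i ∨ r = flip (maxLt4 i)) ∨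
        (∃ i : Fin 4, i ≠ 0 ∧ (r = degMaxLt4 i ∨ r = flip (degMaxLt4 i) ∨
          r = revdegMaxLt4 i ∨ r = flip (revdegMaxLt4 i)))} := by
  ext r
  constructor
  · rintro ⟨T, hT, hne, rfl⟩
    obtain ⟨G, _, _, _, x, hx⟩ := T.exists_linearOrderedGroup
    exact isListed_of_shiftInvariant hx (hT.shiftInvariant hx) hne
  · exact IsListed.mem_compatible
end
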